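/- Let a_n = p_n be the n-th prime. Then for Lebesgue-almost all α ∈ [0,1] there are infinitely many N such that δ_min^α(N) ≤ 1/(N (log N)² (log₂ N)(log₃ N)). -/

import Mathlib

open MeasureTheory Filter

/-- Distance to the nearest integer. -/
noncomputable def nint (x : ℝ) : ℝ := |x - round x|

/-- `δ_min^α(N) = min { ‖(a_m - a_n) α‖ : 1 ≤ m, n ≤ N, m ≠ n }`. -/
noncomputable def deltaMin (a : ℕ → ℕ) (α : ℝ) (N : ℕ) : ℝ :=
  sInf {x : ℝ | ∃ m n : ℕ, 1 ≤ m ∧ m ≤ N ∧ 1 ≤ n ∧ n ≤ N ∧ m ≠ n ∧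
    x = nint (((a m : ℝ) - (a n : ℝ)) * α)}

/-- `C_N = #(A_N - A_N)` where `A_N = {a_1, …, a_N}`. -/
noncomputable def diffCard (a : ℕ → ℕ) (N : ℕ) : ℕ :=
  (((Finset.Icc 1 N) ×ˢ (Finset.Icc 1 N)).image
    (fun p : ℕ × ℕ => (a p.1 : ℤ) - (a p.2 : ℤ))).card

/-- `log x`, read as `max {1, log x}`. -/
noncomputable def L (x : ℝ) : ℝ := max 1 (Real.log x)

/-- `log₂ x = log log x`, with the `max {1, ·}` convention. -/
noncomputable def LL (x : ℝ) : ℝ := L (L x)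

/-- `log₃ x = log log log x`, with the `max {1, ·}` convention. -/
noncomputable def LLL (x : ℝ) : ℝ := L (LL x)

/-- The `n`-th prime number (`nthPrime 1 = 2`). -/
noncomputable def nthPrime (n : ℕ) : ℕ := Nat.nth Nat.Prime (n - 1)

section SelbergWeights

open Finset ArithmeticFunction BoundingSieve
open scoped ArithmeticFunction.Moebius

/-- The denominator `∑_{l ∣ P, l ≤ R} g(l)` of the main term of the Selberg sieve. -/
noncomputable def selbergSum (s : BoundingSieve) (R : ℕ) : ℝ :=
  ∑ l ∈ s.prodPrimes.divisors, if l ≤ R then s.selbergTerms l else 0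

/-- The optimal weights of the Selberg sieve of level `R ^ 2`. -/
noncomputable def selbergWeight (s : BoundingSieve) (R d : ℕ) : ℝ :=
  (s.nu d)⁻¹ * (selbergSum s R)⁻¹ * (μ d *
    ∑ m ∈ s.prodPrimes.divisors, if d ∣ m ∧ m ≤ R then s.selbergTerms m else 0)

variable (s : BoundingSieve) {R : ℕ}

lemma selbergTerms_nonneg_of_mem {l : ℕ} (hl : l ∈ s.prodPrimes.divisors) :
    0 ≤ s.selbergTerms l :=
  (selbergTerms_pos (Nat.dvd_of_mem_divisors hl)).le

lemma selbergSum_pos (hR : 1 ≤ R) : 0 < selbergSum s R := by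
  have h1 : 1 ∈ s.prodPrimes.divisors := by simp [s.prodPrimes_squarefree.ne_zero]
  refine lt_of_lt_of_le ?_ (single_le_sum (f := fun l ↦ if l ≤ R then s.selbergTerms l else 0)
    (fun l hl ↦ ?_) h1)
  · simp only [hR, if_true]
    exact selbergTerms_pos (one_dvd _)
  · split_ifs
    exacts [selbergTerms_nonneg_of_mem s hl, le_rfl]

lemma selbergWeight_one (hR : 1 ≤ R) : selbergWeight s R 1 = 1 := by
  have h : (∑ m ∈ s.prodPrimes.divisors, if 1 ∣ m ∧ m ≤ R then s.selbergTerms m else 0) =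
      selbergSum s R := by simp [selbergSum]
  have := (selbergSum_pos s hR).ne'
  rw [selbergWeight, h]
  simp [s.nu_mult.map_one, this]

lemma selbergWeight_eq_zero {d : ℕ} (hd : R < d) : selbergWeight s R d = 0 := by
  rw [selbergWeight, sum_eq_zero, mul_zero, mul_zero]
  intro m hm
  rw [if_neg]
  rintro ⟨h1, h2⟩
  have := Nat.le_of_dvd (Nat.pos_of_mem_divisors hm) h1
  omega

lemma abs_selbergWeight_le (hR : 1 ≤ R) {d : ℕ} (hd : d ∣ s.prodPrimes) :
    |selbergWeight s R d| ≤ (s.nu d)⁻¹ := by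
  have hS := selbergSum_pos s hR
  have hν := nu_pos_of_dvd_prodPrimes hd
  have hT0 : 0 ≤ ∑ m ∈ s.prodPrimes.divisors,
      if d ∣ m ∧ m ≤ R then s.selbergTerms m else 0 := sum_nonneg fun m hm ↦ by
    split_ifs
    exacts [selbergTerms_nonneg_of_mem s hm, le_rfl]
  have hT : (∑ m ∈ s.prodPrimes.divisors, if d ∣ m ∧ m ≤ R then s.selbergTerms m else 0) ≤
      selbergSum s R := sum_le_sum fun m hm ↦ by
    have := selbergTerms_nonneg_of_mem s hm
    split_ifs <;> grind
  have hμ : |(μ d : ℝ)| ≤ 1 := by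
    exact_mod_cast abs_moebius_le_one (n := d)
  rw [selbergWeight, abs_mul, abs_mul, abs_mul, abs_of_pos (inv_pos.2 hν),
    abs_of_pos (inv_pos.2 hS), abs_of_nonneg hT0, mul_assoc]
  refine mul_le_of_le_one_right (inv_pos.2 hν).le ?_
  rw [inv_mul_le_one₀ hS]
  calc _ ≤ 1 * selbergSum s R := by gcongr
    _ = _ := one_mul _

lemma sum_moebius_between {P l m : ℕ} (hP : P ≠ 0) (hm : m ∣ P) (hms : Squarefree m) :
    (∑ d ∈ P.divisors, if l ∣ d ∧ d ∣ m then (μ d : ℝ) else 0) =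
      if l = m then (μ l : ℝ) else 0 := by
  have hm0 : m ≠ 0 := hms.ne_zero
  by_cases hlm : l ∣ m
  · obtain ⟨k, rfl⟩ := hlm
    obtain ⟨hl0, hk0⟩ := mul_ne_zero_iff.1 hm0
    have hset : {d ∈ P.divisors | l ∣ d ∧ d ∣ l * k} = k.divisors.image (l * ·) := by
      ext d
      simp only [mem_filter, Nat.mem_divisors, mem_image]
      constructor
      · rintro ⟨-, ⟨e, rfl⟩, h⟩
        exact ⟨e, ⟨Nat.dvd_of_mul_dvd_mul_left (Nat.pos_of_ne_zero hl0) h, hk0⟩, rfl⟩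
      · rintro ⟨e, ⟨he, -⟩, rfl⟩
        have : l * e ∣ l * k := mul_dvd_mul_left l he
        exact ⟨⟨this.trans hm, hP⟩, dvd_mul_right _ _, this⟩
    rw [← sum_filter, hset, sum_image (fun a _ b _ h ↦ Nat.eq_of_mul_eq_mul_left
      (Nat.pos_of_ne_zero hl0) h)]
    have hmul : ∀ e ∈ k.divisors, ((μ (l * e) : ℤ) : ℝ) = μ l * μ e := by
      intro e he
      have hsq : Squarefree (l * e) :=
        hms.squarefree_of_dvd (mul_dvd_mul_left l (Nat.dvd_of_mem_divisors he))
      rw [isMultiplicative_moebius.map_mul_of_coprime (Nat.coprime_of_squarefree_mul hsq)]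
      push_cast
      rfl
    rw [sum_congr rfl hmul, ← mul_sum]
    have h1 : (∑ e ∈ k.divisors, (μ e : ℝ)) = if k = 1 then 1 else 0 := by
      have := congrArg (fun f ↦ f k) moebius_mul_coe_zeta
      simp only [coe_mul_zeta_apply, one_apply] at this
      exact_mod_cast this
    rw [h1]
    have : (l = l * k) ↔ k = 1 := by
      constructor
      · intro h
        exact Nat.eq_of_mul_eq_mul_left (Nat.pos_of_ne_zero hl0) (by omega)
      · rintro rfl; simp
    simp [this]
  · rw [if_neg (by rintro rfl; exact hlm dvd_rfl)]
    refine sum_eq_zero fun d _ ↦ if_neg ?_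
    rintro ⟨h1, h2⟩
    exact hlm (h1.trans h2)

lemma sum_nu_mul_selbergWeight {l : ℕ} (hl : l ∈ s.prodPrimes.divisors) :
    (∑ d ∈ s.prodPrimes.divisors, if l ∣ d then s.nu d * selbergWeight s R d else 0) =
      (selbergSum s R)⁻¹ * (if l ≤ R then μ l * s.selbergTerms l else 0) := by
  have h1 : ∀ d ∈ s.prodPrimes.divisors,
      (if l ∣ d then s.nu d * selbergWeight s R d else 0) =
        (selbergSum s R)⁻¹ * ∑ m ∈ s.prodPrimes.divisors,
          (if m ≤ R then s.selbergTerms m else 0) * (if l ∣ d ∧ d ∣ m then (μ d : ℝ) else 0) := by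
    intro d hd
    have hν := (nu_pos_of_dvd_prodPrimes (Nat.dvd_of_mem_divisors hd)).ne'
    by_cases hld : l ∣ d
    · simp only [hld, if_true, true_and, selbergWeight, mul_sum]
      refine sum_congr rfl fun m _ ↦ ?_
      by_cases h1 : d ∣ m <;> by_cases h2 : m ≤ R <;> simp [h1, h2]
      field_simp
    · simp [hld]
  rw [sum_congr rfl h1, ← mul_sum, sum_comm]
  congr 1
  have h2 : ∀ m ∈ s.prodPrimes.divisors, (∑ d ∈ s.prodPrimes.divisors,
      (if m ≤ R then s.selbergTerms m else 0) * (if l ∣ d ∧ d ∣ m then (μ d : ℝ) else 0)) =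
      if l = m then (if m ≤ R then s.selbergTerms m else 0) * μ m else 0 := by
    intro m hm
    rw [← mul_sum, sum_moebius_between prodPrimes_ne_zero (Nat.dvd_of_mem_divisors hm)
      (squarefree_of_mem_divisors_prodPrimes hm)]
    split_ifs <;> simp_all
  rw [sum_congr rfl h2, sum_ite_eq, if_pos hl]
  split_ifs <;> simp [mul_comm]

lemma mainSum_selbergWeight (hR : 1 ≤ R) :
    s.mainSum (lambdaSquared (selbergWeight s R)) = (selbergSum s R)⁻¹ := by
  have hS := (selbergSum_pos s hR).ne'
  rw [mainSum_lambdaSquared_eq_sum_mul_sum_sq]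
  have : ∀ l ∈ s.prodPrimes.divisors, (s.selbergTerms l)⁻¹ *
      (∑ d ∈ s.prodPrimes.divisors, if l ∣ d then s.nu d * selbergWeight s R d else 0) ^ 2 =
      ((selbergSum s R)⁻¹) ^ 2 * if l ≤ R then s.selbergTerms l else 0 := by
    intro l hl
    have hg := (selbergTerms_pos (Nat.dvd_of_mem_divisors hl)).ne'
    have hμ : (μ l : ℝ) ^ 2 = 1 := by
      exact_mod_cast moebius_sq_eq_one_of_squarefree (squarefree_of_mem_divisors_prodPrimes hl)
    rw [sum_nu_mul_selbergWeight s hl]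
    split_ifs
    · rw [mul_pow, mul_pow, hμ]
      field_simp
    · simp
  rw [sum_congr rfl this, ← mul_sum]
  change _ * selbergSum s R = _
  field_simp

lemma errSum_lambdaSquared_le (w : ℕ → ℝ) :
    s.errSum (lambdaSquared w) ≤ ∑ d1 ∈ s.prodPrimes.divisors, ∑ d2 ∈ s.prodPrimes.divisors,
      |w d1| * |w d2| * |s.rem (d1.lcm d2)| := by
  have h1 : ∀ d ∈ s.prodPrimes.divisors, |lambdaSquared w d| * |s.rem d| ≤
      ∑ d1 ∈ s.prodPrimes.divisors, ∑ d2 ∈ s.prodPrimes.divisors,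
        if d = d1.lcm d2 then |w d1| * |w d2| * |s.rem d| else 0 := by
    intro d hd
    have hsub : d.divisors ⊆ s.prodPrimes.divisors :=
      Nat.divisors_subset_of_dvd prodPrimes_ne_zero (Nat.dvd_of_mem_divisors hd)
    have hnn : ∀ d1 d2 : ℕ, 0 ≤ if d = d1.lcm d2 then |w d1| * |w d2| * |s.rem d| else 0 := by
      intro d1 d2
      split_ifs <;> positivity
    calc |lambdaSquared w d| * |s.rem d|
        ≤ (∑ d1 ∈ d.divisors, ∑ d2 ∈ d.divisors,
            |if d = d1.lcm d2 then w d1 * w d2 else 0|) * |s.rem d| := by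
          gcongr
          exact (abs_sum_le_sum_abs _ _).trans (sum_le_sum fun _ _ ↦ abs_sum_le_sum_abs _ _)
      _ = ∑ d1 ∈ d.divisors, ∑ d2 ∈ d.divisors,
            if d = d1.lcm d2 then |w d1| * |w d2| * |s.rem d| else 0 := by
          simp only [sum_mul]
          refine sum_congr rfl fun _ _ ↦ sum_congr rfl fun _ _ ↦ ?_
          split_ifs <;> simp [abs_mul]
      _ ≤ ∑ d1 ∈ d.divisors, ∑ d2 ∈ s.prodPrimes.divisors,
            if d = d1.lcm d2 then |w d1| * |w d2| * |s.rem d| else 0 :=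
          sum_le_sum fun _ _ ↦ sum_le_sum_of_subset_of_nonneg hsub fun _ _ _ ↦ hnn _ _
      _ ≤ _ := sum_le_sum_of_subset_of_nonneg hsub fun _ _ _ ↦ sum_nonneg fun _ _ ↦ hnn _ _
  refine (sum_le_sum h1).trans (le_of_eq ?_)
  rw [sum_comm]
  refine sum_congr rfl fun d1 hd1 ↦ ?_
  rw [sum_comm]
  refine sum_congr rfl fun d2 hd2 ↦ ?_
  rw [sum_ite_eq_of_mem' _ (d1.lcm d2) _]
  exact Nat.mem_divisors.2 ⟨Nat.lcm_dvd (Nat.dvd_of_mem_divisors hd1)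
    (Nat.dvd_of_mem_divisors hd2), prodPrimes_ne_zero⟩

/-- The Selberg sieve, when `|r_d| ≤ τ(d)` and `ν(d) = τ(d) / d`-type bounds hold. -/
lemma siftedSum_le_selberg (hR : 1 ≤ R)
    (hν : ∀ d ∈ s.prodPrimes.divisors, s.nu d = d.divisors.card / d)
    (hrem : ∀ d ∈ s.prodPrimes.divisors, |s.rem d| ≤ d.divisors.card) :
    s.siftedSum ≤ s.totalMass / selbergSum s R + (R : ℝ) ^ 4 := by
  have hP := prodPrimes_ne_zero (s := s)
  refine (siftedSum_le_mainSum_errSum_of_upperMoebius _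
    (upperMoebius_lambdaSquared (selbergWeight s R) (selbergWeight_one s hR))).trans ?_
  rw [mainSum_selbergWeight s hR, ← div_eq_mul_inv]
  gcongr
  refine (errSum_lambdaSquared_le s _).trans ?_
  have key : ∀ d1 ∈ s.prodPrimes.divisors, ∀ d2 ∈ s.prodPrimes.divisors,
      |selbergWeight s R d1| * |selbergWeight s R d2| * |s.rem (d1.lcm d2)| ≤
        (if d1 ≤ R then (d1 : ℝ) else 0) * (if d2 ≤ R then (d2 : ℝ) else 0) := by
    intro d1 hd1 d2 hd2
    by_cases h1 : d1 ≤ R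
    swap
    · simp [selbergWeight_eq_zero s (not_le.1 h1), h1]
    by_cases h2 : d2 ≤ R
    swap
    · simp [selbergWeight_eq_zero s (not_le.1 h2), h2]
    have hw : ∀ d ∈ s.prodPrimes.divisors,
        |selbergWeight s R d| * d.divisors.card ≤ d := by
      intro d hd
      have hd0 := Nat.pos_of_mem_divisors hd
      have := abs_selbergWeight_le s hR (Nat.dvd_of_mem_divisors hd)
      rw [hν d hd, inv_div] at this
      have hc : (0 : ℝ) < d.divisors.card := by
        exact_mod_cast card_pos.2 ⟨1, by simp [hd0.ne']⟩
      rwa [le_div_iff₀ hc] at this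
    have hl : d1.lcm d2 ∈ s.prodPrimes.divisors :=
      Nat.mem_divisors.2 ⟨Nat.lcm_dvd (Nat.dvd_of_mem_divisors hd1)
        (Nat.dvd_of_mem_divisors hd2), hP⟩
    have hcard : ((d1.lcm d2).divisors.card : ℝ) ≤ d1.divisors.card * d2.divisors.card := by
      have h := (isMultiplicative_sigma (k := 0)).lcm_apply_mul_gcd_apply (x := d1) (y := d2)
      simp only [sigma_zero_apply] at h
      have hg : 1 ≤ (d1.gcd d2).divisors.card :=
        card_pos.2 ⟨1, by simp [(Nat.pos_of_mem_divisors hd1).ne']⟩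
      have : (d1.lcm d2).divisors.card ≤ d1.divisors.card * d2.divisors.card :=
        h ▸ Nat.le_mul_of_pos_right _ hg
      exact_mod_cast this
    rw [if_pos h1, if_pos h2]
    calc _ ≤ |selbergWeight s R d1| * |selbergWeight s R d2| *
          (d1.divisors.card * d2.divisors.card) := by
          gcongr
          exact (hrem _ hl).trans hcard
      _ = (|selbergWeight s R d1| * d1.divisors.card) *
          (|selbergWeight s R d2| * d2.divisors.card) := by ring
      _ ≤ _ := mul_le_mul (hw _ hd1) (hw _ hd2) (by positivity) (by positivity)
  refine (sum_le_sum fun d1 hd1 ↦ sum_le_sum fun d2 hd2 ↦ key d1 hd1 d2 hd2).trans ?_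
  rw [← sum_mul_sum]
  have hsum : (∑ d ∈ s.prodPrimes.divisors, if d ≤ R then (d : ℝ) else 0) ≤ (R : ℝ) ^ 2 := by
    rw [← sum_filter]
    calc _ ≤ ∑ d ∈ Icc 1 R, (R : ℝ) := by
          refine (sum_le_sum fun d hd ↦ ?_).trans (sum_le_sum_of_subset_of_nonneg ?_ ?_)
          · exact_mod_cast (mem_filter.1 hd).2
          · intro d hd
            have := mem_filter.1 hd
            exact mem_Icc.2 ⟨Nat.pos_of_mem_divisors this.1, this.2⟩
          · intros; positivity
      _ = _ := by simp [sq]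
  have hnn : 0 ≤ ∑ d ∈ s.prodPrimes.divisors, if d ≤ R then (d : ℝ) else 0 :=
    sum_nonneg fun d _ ↦ by split_ifs <;> positivity
  calc _ ≤ (R : ℝ) ^ 2 * (R : ℝ) ^ 2 := by gcongr
    _ = _ := by ring

end SelbergWeights

section ReciprocalSums

open Finset

lemma sum_le_sum_of_leftInverse {α β : Type*} (s : Finset α) (t : Finset β) (f : α → ℝ)
    (F : β → ℝ) (g : β → α) (hF : ∀ b ∈ t, 0 ≤ F b)
    (h : ∀ a ∈ s, ∃ b ∈ t, g b = a ∧ f a ≤ F b) : ∑ a ∈ s, f a ≤ ∑ b ∈ t, F b := by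
  classical
  rcases s.eq_empty_or_nonempty with rfl | ⟨a₀, ha₀⟩
  · simpa using sum_nonneg hF
  have : Nonempty β := ⟨(h a₀ ha₀).choose⟩
  choose! i hit hig hif using h
  have hinj : Set.InjOn i s := fun a ha b hb hab ↦ by rw [← hig a ha, ← hig b hb, hab]
  calc ∑ a ∈ s, f a ≤ ∑ a ∈ s, F (i a) := sum_le_sum hif
    _ = ∑ b ∈ s.image i, F b := (sum_image hinj).symm
    _ ≤ _ := sum_le_sum_of_subset_of_nonneg (image_subset_iff.2 hit) fun b hb _ ↦ hF b hb

lemma sum_Icc_inv_sq_le (n : ℕ) : ∑ k ∈ Icc 1 n, 1 / (k : ℝ) ^ 2 ≤ 2 := by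
  have h := sum_Ioo_inv_sq_le (α := ℝ) 0 (n + 1)
  have hs : Ioo 0 (n + 1) = Icc 1 n := by ext; simp; omega
  rw [hs] at h
  simpa using h

lemma log_le_sum_Icc_inv (n : ℕ) : Real.log n ≤ ∑ a ∈ Icc 1 n, 1 / (a : ℝ) := by
  rcases Nat.eq_zero_or_pos n with rfl | hn
  · simp
  have h := log_add_one_le_harmonic n
  rw [harmonic_eq_sum_Icc] at h
  push_cast at h
  simp only [one_div]
  refine le_trans (Real.log_le_log (by positivity) ?_) h
  linarith

/-- Squarefree numbers up to `y` coprime to `m`. -/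
def sqfreeCoprime (m y : ℕ) : Finset ℕ := {l ∈ Icc 1 y | Squarefree l ∧ l.Coprime m}

/-- The sum of the reciprocals of the squarefree divisors of `m`. -/
noncomputable def sqfreeSigma (m : ℕ) : ℝ := ∑ d ∈ m.divisors with Squarefree d, 1 / (d : ℝ)

lemma sqfreeSigma_nonneg (m : ℕ) : 0 ≤ sqfreeSigma m := sum_nonneg fun _ _ ↦ by positivity

lemma log_le_mul_sum_sqfreeCoprime {m : ℕ} (hm : m ≠ 0) (y : ℕ) :
    Real.log y ≤ 2 * sqfreeSigma m * ∑ l ∈ sqfreeCoprime m y, 1 / (l : ℝ) := by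
  have h : ∑ a ∈ Icc 1 y, 1 / (a : ℝ) ≤
      ∑ b ∈ Icc 1 y ×ˢ ({d ∈ m.divisors | Squarefree d} ×ˢ sqfreeCoprime m y),
        1 / (b.1 : ℝ) ^ 2 * (1 / (b.2.1 : ℝ) * (1 / (b.2.2 : ℝ))) := by
    refine sum_le_sum_of_leftInverse _ _ _ _ (fun b ↦ b.1 ^ 2 * (b.2.1 * b.2.2))
      (fun _ _ ↦ by positivity) fun a ha ↦ ?_
    obtain ⟨l, k, hkl, hl⟩ := Nat.sq_mul_squarefree a
    have ha1 := mem_Icc.1 ha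
    have hk0 : 0 < k := Nat.pos_of_ne_zero (by rintro rfl; simp at hkl; omega)
    have hl0 : 0 < l := Nat.pos_of_ne_zero hl.ne_zero
    obtain ⟨l2, hl2⟩ := Nat.gcd_dvd_left l m
    have hl2' := hl
    rw [hl2] at hl2'
    have hl20 : 0 < l2 := Nat.pos_of_ne_zero (by rintro rfl; simp at hl2; omega)
    have hg0 : 0 < l.gcd m := Nat.gcd_pos_of_pos_left _ hl0
    have hcop := Nat.coprime_of_squarefree_mul hl2'
    have hl2m : l2.Coprime m := by
      have : (l2.gcd m) ∣ l.gcd m := Nat.dvd_gcd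
        ((Nat.gcd_dvd_left _ _).trans (hl2 ▸ dvd_mul_left _ _)) (Nat.gcd_dvd_right _ _)
      exact Nat.eq_one_of_dvd_coprimes hcop this (Nat.gcd_dvd_left _ _)
    refine ⟨(k, l.gcd m, l2), ?_, ?_, ?_⟩
    · simp only [mem_product, mem_Icc, mem_filter, Nat.mem_divisors, sqfreeCoprime]
      refine ⟨⟨hk0, ?_⟩, ⟨⟨Nat.gcd_dvd_right _ _, hm⟩,
        hl2'.squarefree_of_dvd (dvd_mul_right _ _)⟩, ⟨hl20, ?_⟩,
        hl2'.squarefree_of_dvd (dvd_mul_left _ _), hl2m⟩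
      · nlinarith
      · calc l2 ≤ l.gcd m * l2 := Nat.le_mul_of_pos_left _ hg0
          _ = l := hl2.symm
          _ ≤ k ^ 2 * l := Nat.le_mul_of_pos_left _ (by positivity)
          _ ≤ y := hkl ▸ ha1.2
    · dsimp only
      rw [← hl2, hkl]
    · dsimp only
      rw [← hkl]
      nth_rw 1 [hl2]
      push_cast
      rw [one_div_mul_one_div, one_div_mul_one_div]
  simp only [sum_product] at h
  simp only [← mul_sum, ← sum_mul] at h
  refine (log_le_sum_Icc_inv y).trans (h.trans ?_)
  rw [mul_assoc]
  refine mul_le_mul_of_nonneg_right (sum_Icc_inv_sq_le y) (mul_nonneg (sqfreeSigma_nonneg m) ?_)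
  positivity

lemma sq_sum_sqfreeCoprime_le (m y : ℕ) :
    (∑ l ∈ sqfreeCoprime m y, 1 / (l : ℝ)) ^ 2 ≤
      2 * ∑ l ∈ sqfreeCoprime m (y ^ 2), (l.divisors.card : ℝ) / l := by
  have h : ∑ p ∈ sqfreeCoprime m y ×ˢ sqfreeCoprime m y, 1 / (p.1 : ℝ) * (1 / (p.2 : ℝ)) ≤
      ∑ b ∈ Icc 1 y ×ˢ ((sqfreeCoprime m (y ^ 2)).sigma fun l ↦ l.divisors),
        1 / (b.1 : ℝ) ^ 2 * (1 / (b.2.1 : ℝ)) := by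
    refine sum_le_sum_of_leftInverse _ _ _ _
      (fun b ↦ (b.1 * b.2.2, b.1 * (b.2.1 / b.2.2))) (fun _ _ ↦ by positivity) ?_
    rintro ⟨l1, l2⟩ hp
    simp only [mem_product, sqfreeCoprime, mem_filter, mem_Icc] at hp
    obtain ⟨⟨⟨h1, h1y⟩, hs1, hc1⟩, ⟨h2, h2y⟩, hs2, hc2⟩ := hp
    obtain ⟨g, a, b, hg, hab, rfl, rfl⟩ := Nat.exists_coprime' (m := l1) (n := l2)
      (Nat.gcd_pos_of_pos_left _ h1)
    have ha0 : 0 < a := Nat.pos_of_ne_zero (by rintro rfl; simp at h1)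
    have hb0 : 0 < b := Nat.pos_of_ne_zero (by rintro rfl; simp at h2)
    refine ⟨(g, ⟨a * b, a⟩), ?_, ?_, ?_⟩
    · simp only [mem_product, mem_sigma, sqfreeCoprime, mem_filter, mem_Icc, Nat.mem_divisors]
      have hay : a ≤ y := by nlinarith
      have hby : b ≤ y := by nlinarith
      refine ⟨⟨hg, by nlinarith⟩, ⟨⟨Nat.mul_pos ha0 hb0, by nlinarith⟩, ?_, ?_⟩,
        dvd_mul_right _ _, (Nat.mul_pos ha0 hb0).ne'⟩
      · exact (Nat.squarefree_mul hab).2 ⟨hs1.squarefree_of_dvd (dvd_mul_right _ _),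
          hs2.squarefree_of_dvd (dvd_mul_right _ _)⟩
      · exact Nat.Coprime.mul_left (hc1.coprime_dvd_left (dvd_mul_right _ _))
          (hc2.coprime_dvd_left (dvd_mul_right _ _))
    · dsimp only
      rw [Nat.mul_div_cancel_left _ ha0, mul_comm g, mul_comm g]
    · dsimp only
      push_cast
      apply le_of_eq
      field_simp
  simp only [sum_product, sum_sigma] at h
  simp only [← mul_sum, ← sum_mul] at h
  rw [sq]
  refine h.trans ?_
  have : ∀ l ∈ sqfreeCoprime m (y ^ 2), ∑ _a ∈ l.divisors, 1 / (l : ℝ) =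
      (l.divisors.card : ℝ) / l := fun l _ ↦ by
    rw [sum_const, nsmul_eq_mul, mul_one_div]
  rw [sum_congr rfl this]
  exact mul_le_mul_of_nonneg_right (sum_Icc_inv_sq_le y) (by positivity)

lemma sqfreeSigma_le {m : ℕ} (hm : m ≠ 0) : sqfreeSigma m ≤ m / m.totient := by
  have hm' : 0 < m := Nat.pos_of_ne_zero hm
  have h1 : sqfreeSigma m = ∏ p ∈ m.primeFactors, (1 + 1 / (p : ℝ)) := by
    rw [sqfreeSigma, Nat.sum_divisors_filter_squarefree hm, prod_one_add, Nat.factors_eq]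
    refine sum_congr rfl fun t ht ↦ ?_
    simp
  have h2 : ((m.totient : ℕ) : ℝ) = m * ∏ p ∈ m.primeFactors, (1 - 1 / (p : ℝ)) := by
    have := Nat.totient_eq_mul_prod_factors m
    have h3 : ((m.totient : ℚ) : ℝ) = ((m * ∏ p ∈ m.primeFactors, (1 - (p : ℚ)⁻¹) : ℚ) : ℝ) := by
      rw [this]
    push_cast at h3
    simpa using h3
  have hφ : (0 : ℝ) < m.totient := by exact_mod_cast Nat.totient_pos.2 hm'
  rw [le_div_iff₀ hφ, h1, h2, mul_left_comm, ← prod_mul_distrib]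
  refine mul_le_of_le_one_right (by positivity) (prod_le_one (fun p hp ↦ ?_) fun p hp ↦ ?_)
  · have : (1 : ℝ) ≤ p := by exact_mod_cast (Nat.prime_of_mem_primeFactors hp).one_le
    have : 1 / (p : ℝ) ≤ 1 := by rw [div_le_one (by positivity)]; exact this
    have : 0 ≤ 1 / (p : ℝ) := by positivity
    nlinarith
  · nlinarith [sq_nonneg (1 / (p : ℝ))]

end ReciprocalSums

section TwinSieve

open Finset ArithmeticFunction BoundingSieve
open scoped ArithmeticFunction.sigma

lemma abs_card_modEq_sub_le (X c : ℕ) {d : ℕ} (hd : 0 < d) :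
    |((#{n ∈ Icc 1 X | n ≡ c [MOD d]} : ℕ) : ℝ) - X / d| ≤ 1 := by
  have h := Nat.Ioc_filter_modEq_card 0 X hd c
  have hs : Ioc 0 X = Icc 1 X := by ext; simp; omega
  rw [hs] at h
  have hd' : (0 : ℚ) < d := by exact_mod_cast hd
  have hle : ⌊((0 : ℕ) - c : ℚ) / d⌋ ≤ ⌊((X : ℕ) - c : ℚ) / d⌋ := by
    apply Int.floor_le_floor
    gcongr
    simp
  rw [max_eq_left (by linarith)] at h
  have h1 := Int.floor_le (((0 : ℕ) - c : ℚ) / d)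
  have h2 := Int.lt_floor_add_one (((0 : ℕ) - c : ℚ) / d)
  have h3 := Int.floor_le (((X : ℕ) - c : ℚ) / d)
  have h4 := Int.lt_floor_add_one (((X : ℕ) - c : ℚ) / d)
  have hq : ((#{n ∈ Icc 1 X | n ≡ c [MOD d]} : ℕ) : ℚ) =
      ⌊((X : ℕ) - c : ℚ) / d⌋ - ⌊((0 : ℕ) - c : ℚ) / d⌋ := by exact_mod_cast h
  have h5 : ((X : ℕ) - c : ℚ) / d - ((0 : ℕ) - c : ℚ) / d = X / d := by
    push_cast; ring
  have h6 : |((#{n ∈ Icc 1 X | n ≡ c [MOD d]} : ℕ) : ℚ) - X / d| ≤ 1 := by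
    rw [hq, abs_le]
    constructor <;> linarith
  have h7 := (Rat.cast_le (K := ℝ)).2 h6
  push_cast at h7
  exact h7

lemma abs_card_dvd_and_dvd_sub_le (X h : ℕ) {e f : ℕ} (hef : e.Coprime f) (he : 0 < e)
    (hf : 0 < f) : |((#{n ∈ Icc 1 X | e ∣ n ∧ f ∣ n + h} : ℕ) : ℝ) - X / (e * f : ℕ)| ≤ 1 := by
  obtain ⟨c, hc1, hc2⟩ := Nat.chineseRemainder hef 0 (h * (f - 1))
  convert abs_card_modEq_sub_le X c (Nat.mul_pos he hf) using 5
  refine filter_congr fun n _ ↦ ?_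
  rw [← Nat.modEq_and_modEq_iff_modEq_mul hef]
  have h1 : e ∣ n ↔ n ≡ c [MOD e] :=
    ⟨fun h ↦ ((Nat.modEq_zero_iff_dvd).2 h).trans hc1.symm,
      fun h ↦ (Nat.modEq_zero_iff_dvd).1 (h.trans hc1)⟩
  have hch : c + h ≡ 0 [MOD f] := by
    have h2 : h * (f - 1) + h = h * f := by
      obtain ⟨g, rfl⟩ : ∃ g, f = g + 1 := ⟨f - 1, by omega⟩
      simp; ring
    have := hc2.add_right h
    rw [h2] at this
    exact this.trans ((Nat.modEq_zero_iff_dvd).2 (dvd_mul_left _ _))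
  have h2 : f ∣ n + h ↔ n ≡ c [MOD f] :=
    ⟨fun h ↦ (((Nat.modEq_zero_iff_dvd).2 h).trans hch.symm).add_right_cancel' _,
      fun h' ↦ (Nat.modEq_zero_iff_dvd).1 ((h'.add_right h).trans hch)⟩
  rw [h1, h2]

lemma abs_card_dvd_mul_sub_le (X h : ℕ) {d : ℕ} (hd : Squarefree d) (hdh : d.Coprime h) :
    |((#{n ∈ Icc 1 X | d ∣ n * (n + h)} : ℕ) : ℝ) - d.divisors.card / d * X| ≤
      d.divisors.card := by
  have hd0 : d ≠ 0 := hd.ne_zero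
  have hfib : #{n ∈ Icc 1 X | d ∣ n * (n + h)} =
      ∑ e ∈ d.divisors, #{n ∈ Icc 1 X | e ∣ n ∧ d / e ∣ n + h} := by
    rw [card_eq_sum_card_fiberwise (f := fun n ↦ d.gcd n) (t := d.divisors)]
    · refine sum_congr rfl fun e he ↦ ?_
      rw [filter_filter]
      congr 1
      refine filter_congr fun n _ ↦ ?_
      obtain ⟨f, rfl⟩ := Nat.dvd_of_mem_divisors he
      obtain ⟨he0, hf0⟩ := mul_ne_zero_iff.1 hd0
      have hef := Nat.coprime_of_squarefree_mul hd
      rw [Nat.mul_div_cancel_left _ (Nat.pos_of_ne_zero he0)]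
      constructor
      · rintro ⟨h1, h2⟩
        have hen : e ∣ n := h2 ▸ Nat.gcd_dvd_right _ _
        refine ⟨hen, ?_⟩
        have hfn : f.Coprime n := by
          rw [Nat.gcd_comm, Nat.Coprime.gcd_mul n hef, Nat.gcd_comm n, Nat.gcd_comm n] at h2
          have h3 : e.gcd n = e := Nat.gcd_eq_left hen
          rw [h3] at h2
          exact Nat.eq_of_mul_eq_mul_left (Nat.pos_of_ne_zero he0) (by rw [h2, mul_one])
        exact hfn.dvd_of_dvd_mul_left ((dvd_mul_left f e).trans h1)
      · rintro ⟨h1, h2⟩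
        refine ⟨mul_dvd_mul h1 h2, ?_⟩
        rw [Nat.gcd_comm, Nat.Coprime.gcd_mul n hef, Nat.gcd_comm n, Nat.gcd_comm n,
          Nat.gcd_eq_left h1]
        have h3 : f.gcd n ∣ h := (Nat.dvd_add_right (Nat.gcd_dvd_right f n)).1
          ((Nat.gcd_dvd_left f n).trans h2)
        have h4 : f.Coprime h := hdh.coprime_dvd_left (dvd_mul_left _ _)
        have : f.gcd n = 1 := Nat.eq_one_of_dvd_coprimes h4 (Nat.gcd_dvd_left f n) h3
        rw [this, mul_one]
    · intro n _
      simp [hd0, Nat.gcd_dvd_left]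
  have hsum : (d.divisors.card : ℝ) / d * X = ∑ e ∈ d.divisors, (X : ℝ) / d := by
    rw [sum_const, nsmul_eq_mul]; ring
  rw [hfib, hsum]
  push_cast
  rw [← sum_sub_distrib]
  refine (abs_sum_le_sum_abs _ _).trans ?_
  calc _ ≤ ∑ e ∈ d.divisors, (1 : ℝ) := by
        refine sum_le_sum fun e he ↦ ?_
        obtain ⟨f, rfl⟩ := Nat.dvd_of_mem_divisors he
        obtain ⟨he0, hf0⟩ := mul_ne_zero_iff.1 hd0
        rw [Nat.mul_div_cancel_left _ (Nat.pos_of_ne_zero he0)]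
        exact abs_card_dvd_and_dvd_sub_le X h (Nat.coprime_of_squarefree_mul hd)
          (Nat.pos_of_ne_zero he0) (Nat.pos_of_ne_zero hf0)
    _ = _ := by simp

/-- The primes up to `R` used to sift `n (n + h)`. -/
def twinPrimeSet (h R : ℕ) : Finset ℕ := {p ∈ Icc 1 R | p.Prime ∧ ¬ p ∣ 2 * h}

lemma squarefree_prod_primes {S : Finset ℕ} (hS : ∀ p ∈ S, p.Prime) :
    Squarefree (∏ p ∈ S, p) := by
  refine Finset.squarefree_prod_of_pairwise_isCoprime (fun p hp q hq hpq ↦ ?_)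
    fun p hp ↦ (hS p hp).squarefree
  simpa [Function.onFun, Nat.coprime_iff_isRelPrime] using
    (Nat.coprime_primes (hS p hp) (hS q hq)).2 hpq

lemma prime_dvd_prod_primes {S : Finset ℕ} (hS : ∀ p ∈ S, p.Prime) {q : ℕ} (hq : q.Prime)
    (h : q ∣ ∏ p ∈ S, p) : q ∈ S := by
  obtain ⟨p, hp, hqp⟩ := (Prime.dvd_finsetProd_iff hq.prime _).1 h
  rwa [(Nat.prime_dvd_prime_iff_eq hq (hS p hp)).1 hqp]

lemma prime_of_mem_twinPrimeSet {h R : ℕ} : ∀ p ∈ twinPrimeSet h R, p.Prime :=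
  fun _ hp ↦ (mem_filter.1 hp).2.1

/-- The sieve problem for `{n (n + h) : 1 ≤ n ≤ X}` with sifting primes not dividing `2 h`. -/
noncomputable def twinSieve (X h R : ℕ) : BoundingSieve where
  support := (Icc 1 X).image fun n ↦ n * (n + h)
  prodPrimes := ∏ p ∈ twinPrimeSet h R, p
  prodPrimes_squarefree := squarefree_prod_primes prime_of_mem_twinPrimeSet
  weights := fun _ ↦ 1
  weights_nonneg := fun _ ↦ zero_le_one
  totalMass := X
  nu := ((σ 0 : ArithmeticFunction ℕ) : ArithmeticFunction ℝ).pdiv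
    ((ArithmeticFunction.id : ArithmeticFunction ℕ) : ArithmeticFunction ℝ)
  nu_mult := isMultiplicative_sigma.natCast.pdiv isMultiplicative_id.natCast
  nu_pos_of_prime := fun p hp _ ↦ by
    have := hp.pos
    simp [pdiv_apply, sigma_zero_apply, hp.divisors, hp.ne_one.symm, this]
  nu_lt_one_of_prime := fun p hp hpP ↦ by
    have h2 : p ≠ 2 := by
      rintro rfl
      have := prime_dvd_prod_primes prime_of_mem_twinPrimeSet hp hpP
      simp [twinPrimeSet] at this
    have h3 : 2 < p := lt_of_le_of_ne hp.two_le h2.symm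
    have h3' : (2 : ℝ) < p := by exact_mod_cast h3
    have : #({1, p} : Finset ℕ) = 2 := card_pair hp.ne_one.symm
    simp only [pdiv_apply, natCoe_apply, sigma_zero_apply, hp.divisors, this, id_apply]
    rw [div_lt_one (by linarith)]
    exact_mod_cast h3

lemma twinSieve_nu (X h R d : ℕ) : (twinSieve X h R).nu d = d.divisors.card / d := by
  simp [twinSieve, pdiv_apply, sigma_zero_apply]

lemma injOn_mul_add (X h : ℕ) : Set.InjOn (fun n ↦ n * (n + h)) (Icc 1 X : Finset ℕ) := by
  intro a ha b hb hab
  have ha1 := (mem_Icc.1 ha).1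
  have hb1 := (mem_Icc.1 hb).1
  simp only at hab
  by_contra hne
  rcases lt_or_gt_of_ne hne with h1 | h1 <;> nlinarith

lemma abs_rem_twinSieve_le (X h R : ℕ) {d : ℕ} (hd : d ∈ (twinSieve X h R).prodPrimes.divisors) :
    |(twinSieve X h R).rem d| ≤ d.divisors.card := by
  have hsq := squarefree_of_mem_divisors_prodPrimes hd
  have hcop : d.Coprime h := by
    refine Nat.Coprime.coprime_dvd_left (Nat.dvd_of_mem_divisors hd) ?_
    change (∏ p ∈ twinPrimeSet h R, p).Coprime h
    refine Nat.Coprime.prod_left fun p hp ↦ ?_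
    have hp' := mem_filter.1 hp
    exact (Nat.Prime.coprime_iff_not_dvd hp'.2.1).2 fun h1 ↦ hp'.2.2 (h1.mul_left 2)
  have hm : (twinSieve X h R).multSum d = (#{n ∈ Icc 1 X | d ∣ n * (n + h)} : ℕ) := by
    rw [multSum]
    change ∑ n ∈ (Icc 1 X).image (fun n ↦ n * (n + h)), (if d ∣ n then (1 : ℝ) else 0) = _
    rw [sum_image (injOn_mul_add X h)]
    simp
  rw [rem, hm, twinSieve_nu]
  exact abs_card_dvd_mul_sub_le X h hsq hcop

lemma sum_sqfreeCoprime_le_selbergSum (X h R : ℕ) :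
    ∑ l ∈ sqfreeCoprime (2 * h) R, (l.divisors.card : ℝ) / l ≤ selbergSum (twinSieve X h R) R := by
  set s := twinSieve X h R
  rw [selbergSum, ← sum_filter]
  have hsub : sqfreeCoprime (2 * h) R ⊆ {l ∈ s.prodPrimes.divisors | l ≤ R} := by
    intro l hl
    simp only [sqfreeCoprime, mem_filter, mem_Icc] at hl
    refine mem_filter.2 ⟨Nat.mem_divisors.2 ⟨?_, prodPrimes_ne_zero⟩, hl.1.2⟩
    rw [← Nat.prod_primeFactors_of_squarefree hl.2.1]
    change _ ∣ ∏ p ∈ twinPrimeSet h R, p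
    refine prod_dvd_prod_of_subset _ _ (fun p ↦ p) fun p hp ↦ ?_
    have hpp := Nat.prime_of_mem_primeFactors hp
    have hpl := Nat.dvd_of_mem_primeFactors hp
    refine mem_filter.2 ⟨mem_Icc.2 ⟨hpp.one_le, (Nat.le_of_dvd hl.1.1 hpl).trans hl.1.2⟩, hpp, ?_⟩
    exact (Nat.Prime.coprime_iff_not_dvd hpp).1 (hl.2.2.coprime_dvd_left hpl)
  refine (sum_le_sum fun l hl ↦ ?_).trans (sum_le_sum_of_subset_of_nonneg hsub fun l hl _ ↦
    selbergTerms_nonneg_of_mem s (mem_filter.1 hl).1)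
  have hlP := Nat.dvd_of_mem_divisors (mem_filter.1 (hsub hl)).1
  rw [selbergTerms_apply, ← twinSieve_nu X h R]
  refine le_mul_of_one_le_right (nu_pos_of_dvd_prodPrimes hlP).le ?_
  have hprime : ∀ p ∈ l.primeFactors, 0 < s.nu p ∧ s.nu p < 1 := fun p hp ↦ by
    have hpp := Nat.prime_of_mem_primeFactors hp
    have hpl := (Nat.dvd_of_mem_primeFactors hp).trans hlP
    exact ⟨s.nu_pos_of_prime p hpp hpl, s.nu_lt_one_of_prime p hpp hpl⟩
  have hle : ∏ p ∈ l.primeFactors, (1 - s.nu p) ≤ 1 :=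
    prod_le_one (fun p hp ↦ by linarith [hprime p hp]) fun p hp ↦ by linarith [hprime p hp]
  have hpos : 0 < ∏ p ∈ l.primeFactors, (1 - s.nu p) :=
    prod_pos fun p hp ↦ by linarith [hprime p hp]
  rw [prod_inv_distrib]
  exact (one_le_inv₀ hpos).2 hle

/-- The number of `n ≤ X` such that `n` and `n + h` are both prime. -/
def twinCount (X h : ℕ) : ℕ := #{n ∈ Icc 1 X | n.Prime ∧ (n + h).Prime}

lemma twinCount_le_add_siftedSum (X h R : ℕ) :
    (twinCount X h : ℝ) ≤ R + (twinSieve X h R).siftedSum := by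
  have hs : (twinSieve X h R).siftedSum =
      (#{n ∈ Icc 1 X | (∏ p ∈ twinPrimeSet h R, p).Coprime (n * (n + h))} : ℕ) := by
    rw [siftedSum]
    change ∑ n ∈ (Icc 1 X).image (fun n ↦ n * (n + h)),
      (if (∏ p ∈ twinPrimeSet h R, p).Coprime n then (1 : ℝ) else 0) = _
    rw [sum_image (injOn_mul_add X h)]
    simp
  rw [hs]
  have hsub : {n ∈ Icc 1 X | n.Prime ∧ (n + h).Prime} ⊆ Icc 1 R ∪
      {n ∈ Icc 1 X | (∏ p ∈ twinPrimeSet h R, p).Coprime (n * (n + h))} := by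
    intro n hn
    obtain ⟨hnX, hn1, hn2⟩ := mem_filter.1 hn
    by_cases hnR : n ≤ R
    · exact mem_union_left _ (mem_Icc.2 ⟨(mem_Icc.1 hnX).1, hnR⟩)
    refine mem_union_right _ (mem_filter.2 ⟨hnX, Nat.Coprime.prod_left fun p hp ↦ ?_⟩)
    obtain ⟨hpR, hpp, -⟩ := mem_filter.1 hp
    have hpR := (mem_Icc.1 hpR).2
    exact Nat.Coprime.mul_right ((Nat.coprime_primes hpp hn1).2 (by omega))
      ((Nat.coprime_primes hpp hn2).2 (by omega))
  have := (card_le_card hsub).trans (card_union_le _ _)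
  rw [Nat.card_Icc, Nat.add_sub_cancel] at this
  exact_mod_cast this

lemma sqfreeSigma_two_mul_le {h : ℕ} (hh : h ≠ 0) :
    sqfreeSigma (2 * h) ≤ 2 * (h / h.totient) := by
  refine (sqfreeSigma_le (mul_ne_zero two_ne_zero hh)).trans ?_
  have h1 : (0 : ℝ) < h.totient := by exact_mod_cast Nat.totient_pos.2 (Nat.pos_of_ne_zero hh)
  have h2 : (h.totient : ℝ) ≤ (2 * h).totient := by
    exact_mod_cast Nat.le_of_dvd (Nat.totient_pos.2 (by omega))
      (Nat.totient_dvd_of_dvd (dvd_mul_left _ _))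
  push_cast
  rw [mul_div_assoc]
  gcongr

/-- An upper bound of the correct order of magnitude, up to the exponent of `h / φ(h)`, for the
number of prime pairs with difference `h`. -/
lemma twinCount_le {y h : ℕ} (hy : 2 ≤ y) (hh : h ≠ 0) :
    (twinCount (y ^ 16) h : ℝ) ≤ 10000 * (h / h.totient) ^ 2 *
      ((y : ℝ) ^ 16 / Real.log ((y : ℝ) ^ 16) ^ 2) := by
  have hy' : (2 : ℝ) ≤ y := by exact_mod_cast hy
  have hlog : 0 < Real.log y := Real.log_pos (by linarith)
  have hlogy : Real.log y ≤ y := (Real.log_le_sub_one_of_pos (by linarith)).trans (by linarith)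
  set F : ℝ := h / h.totient with hF
  have hF1 : 1 ≤ F := by
    rw [hF, one_le_div (by exact_mod_cast Nat.totient_pos.2 (Nat.pos_of_ne_zero hh))]
    exact_mod_cast Nat.totient_le h
  set s := twinSieve (y ^ 16) h (y ^ 2)
  have hR : 1 ≤ y ^ 2 := Nat.one_le_pow _ _ (by omega)
  have hsel : s.siftedSum ≤ s.totalMass / selbergSum s (y ^ 2) + ((y ^ 2 : ℕ) : ℝ) ^ 4 :=
    siftedSum_le_selberg s hR (fun d _ ↦ twinSieve_nu _ _ _ d)
      fun d hd ↦ abs_rem_twinSieve_le _ _ _ hd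
  have hcount := twinCount_le_add_siftedSum (y ^ 16) h (y ^ 2)
  have hmass : s.totalMass = (y : ℝ) ^ 16 := by
    change ((y ^ 16 : ℕ) : ℝ) = _
    push_cast; rfl
  set T := ∑ l ∈ sqfreeCoprime (2 * h) y, 1 / (l : ℝ)
  have h1 : T ^ 2 ≤ 2 * selbergSum s (y ^ 2) := (sq_sum_sqfreeCoprime_le (2 * h) y).trans
    (mul_le_mul_of_nonneg_left (sum_sqfreeCoprime_le_selbergSum _ _ _) zero_le_two)
  have hT0 : 0 ≤ T := sum_nonneg fun _ _ ↦ by positivity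
  have h2 : Real.log y ≤ 4 * F * T :=
    (log_le_mul_sum_sqfreeCoprime (mul_ne_zero two_ne_zero hh) y).trans
      (mul_le_mul_of_nonneg_right (by linarith [sqfreeSigma_two_mul_le hh]) hT0)
  have h3 : Real.log y ^ 2 ≤ 32 * F ^ 2 * selbergSum s (y ^ 2) := by
    calc Real.log y ^ 2 ≤ (4 * F * T) ^ 2 := by gcongr
      _ = 16 * F ^ 2 * T ^ 2 := by ring
      _ ≤ 16 * F ^ 2 * (2 * selbergSum s (y ^ 2)) := by gcongr
      _ = _ := by ring
  have hS0 : 0 < selbergSum s (y ^ 2) := selbergSum_pos s hR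
  have h4 : (y : ℝ) ^ 16 / selbergSum s (y ^ 2) ≤ 32 * F ^ 2 * (y : ℝ) ^ 16 / Real.log y ^ 2 := by
    rw [div_le_div_iff₀ hS0 (by positivity)]
    calc _ ≤ (y : ℝ) ^ 16 * (32 * F ^ 2 * selbergSum s (y ^ 2)) := by gcongr
      _ = _ := by ring
  have h5 : (y : ℝ) ^ 8 ≤ (y : ℝ) ^ 16 / Real.log y ^ 2 := by
    rw [le_div_iff₀ (by positivity)]
    calc (y : ℝ) ^ 8 * Real.log y ^ 2 ≤ (y : ℝ) ^ 8 * (y : ℝ) ^ 2 := by gcongr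
      _ = (y : ℝ) ^ 10 := by ring
      _ ≤ (y : ℝ) ^ 16 := pow_le_pow_right₀ (by linarith) (by norm_num)
  have h6 : (y : ℝ) ^ 2 ≤ (y : ℝ) ^ 8 := pow_le_pow_right₀ (by linarith) (by norm_num)
  have h7 : (1 : ℝ) ≤ F ^ 2 := one_le_pow₀ hF1
  rw [Real.log_pow]
  set Q := (y : ℝ) ^ 16 / Real.log y ^ 2 with hQ
  have hQ0 : 0 ≤ Q := by positivity
  have h8 : (y : ℝ) ^ 16 / (((16 : ℕ) : ℝ) * Real.log y) ^ 2 = Q / 256 := by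
    rw [hQ]; field_simp; norm_num
  have h9 : 32 * F ^ 2 * (y : ℝ) ^ 16 / Real.log y ^ 2 = 32 * F ^ 2 * Q := by rw [hQ]; ring
  rw [h8]
  rw [h9] at h4
  rw [hmass] at hsel
  push_cast at hcount hsel
  have h10 : ((y : ℝ) ^ 2) ^ 4 = (y : ℝ) ^ 8 := by ring
  rw [h10] at hsel
  have h11 : Q ≤ F ^ 2 * Q := le_mul_of_one_le_left hQ0 h7
  have h12 : 10000 * F ^ 2 * (Q / 256) = (10000 / 256) * (F ^ 2 * Q) := by ring
  rw [h12]
  nlinarith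

end TwinSieve

section TotientMoments

open Finset

lemma div_totient_eq_prod {h : ℕ} (hh : h ≠ 0) :
    (h : ℝ) / h.totient = ∏ p ∈ h.primeFactors, (1 - (p : ℝ)⁻¹)⁻¹ := by
  have h1 := congrArg (Rat.cast (K := ℝ)) (Nat.totient_eq_mul_prod_factors h)
  push_cast at h1
  have hh' : (h : ℝ) ≠ 0 := by exact_mod_cast hh
  rw [h1, prod_inv_distrib, div_eq_mul_inv, mul_inv, mul_inv_cancel_left₀ hh']

lemma one_sub_inv_inv_pow_le {p : ℕ} (hp : 2 ≤ p) :
    ((1 - (p : ℝ)⁻¹)⁻¹) ^ 5 ≤ 1 + 62 / p := by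
  have hp' : (2 : ℝ) ≤ p := by exact_mod_cast hp
  set t : ℝ := ((p : ℝ) - 1)⁻¹ with ht
  have ht0 : 0 < t := by rw [ht]; exact inv_pos.2 (by linarith)
  have ht1 : t ≤ 1 := inv_le_one_of_one_le₀ (by linarith)
  have ht2 : t ≤ 2 / p := by
    rw [ht, inv_eq_one_div, div_le_div_iff₀ (by linarith) (by linarith)]; linarith
  have h1 : (1 - (p : ℝ)⁻¹)⁻¹ = 1 + t := by
    have : (p : ℝ) - 1 ≠ 0 := by linarith
    rw [ht]; field_simp; ring
  have h2 : t ^ 2 ≤ t := by nlinarith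
  have h3 : t ^ 3 ≤ t := by nlinarith
  have h4 : t ^ 4 ≤ t := by nlinarith
  have h5 : t ^ 5 ≤ t := by nlinarith
  have h6 : 31 * t ≤ 62 / p := by
    calc 31 * t ≤ 31 * (2 / p) := by gcongr
      _ = _ := by ring
  rw [h1]
  nlinarith

lemma sum_div_totient_pow_le (X : ℕ) :
    ∑ h ∈ Icc 1 X, ((h : ℝ) / h.totient) ^ 5 ≤ Real.exp 124 * X := by
  set P := {p ∈ Icc 1 X | p.Prime}
  calc ∑ h ∈ Icc 1 X, ((h : ℝ) / h.totient) ^ 5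
      ≤ ∑ h ∈ Icc 1 X, ∏ p ∈ h.primeFactors, (1 + 62 / (p : ℝ)) := by
        refine sum_le_sum fun h hh ↦ ?_
        rw [div_totient_eq_prod (Nat.one_le_iff_ne_zero.1 (mem_Icc.1 hh).1), ← prod_pow]
        refine prod_le_prod (fun p hp ↦ ?_) fun p hp ↦
          one_sub_inv_inv_pow_le (Nat.prime_of_mem_primeFactors hp).two_le
        have : (p : ℝ)⁻¹ ≤ 1 := Nat.cast_inv_le_one p
        exact pow_nonneg (inv_nonneg.2 (by linarith)) _
    _ ≤ ∑ h ∈ Icc 1 X, ∑ T ∈ P.powerset,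
          if ∏ p ∈ T, p ∣ h then ∏ p ∈ T, 62 / (p : ℝ) else 0 := by
        refine sum_le_sum fun h hh ↦ ?_
        obtain ⟨h1, h2⟩ := mem_Icc.1 hh
        rw [prod_one_add, ← sum_filter]
        refine sum_le_sum_of_subset_of_nonneg (fun T hT ↦ ?_) fun _ _ _ ↦
          prod_nonneg fun _ _ ↦ by positivity
        have hT := mem_powerset.1 hT
        refine mem_filter.2 ⟨mem_powerset.2 fun p hp ↦ ?_,
          (prod_dvd_prod_of_subset _ _ (fun p ↦ p) hT).trans (Nat.prod_primeFactors_dvd h)⟩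
        have hp1 := Nat.prime_of_mem_primeFactors (hT hp)
        exact mem_filter.2 ⟨mem_Icc.2 ⟨hp1.one_le,
          (Nat.le_of_dvd h1 (Nat.dvd_of_mem_primeFactors (hT hp))).trans h2⟩, hp1⟩
    _ ≤ ∑ T ∈ P.powerset, (∏ p ∈ T, 62 / (p : ℝ) ^ 2) * (X : ℝ) := by
        rw [sum_comm]
        refine sum_le_sum fun T _ ↦ ?_
        rw [← sum_filter, sum_const, nsmul_eq_mul]
        have hcard : ((#{h ∈ Icc 1 X | ∏ p ∈ T, p ∣ h} : ℕ) : ℝ) ≤ X / (∏ p ∈ T, p : ℕ) := by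
          have hI : Icc 1 X = Ioc 0 X := by ext; simp; omega
          rw [hI, Nat.Ioc_filter_dvd_card_eq_div]
          exact Nat.cast_div_le
        refine (mul_le_mul_of_nonneg_right hcard
          (prod_nonneg fun _ _ ↦ by positivity)).trans_eq ?_
        rw [Nat.cast_prod, mul_comm, mul_div_assoc', mul_div_right_comm, ← prod_div_distrib]
        congr 1
        exact prod_congr rfl fun p _ ↦ by rw [div_div, sq]
    _ = (∏ p ∈ P, (1 + 62 / (p : ℝ) ^ 2)) * X := by rw [prod_one_add, sum_mul]
    _ ≤ Real.exp 124 * X := by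
        gcongr
        calc ∏ p ∈ P, (1 + 62 / (p : ℝ) ^ 2) ≤ ∏ p ∈ P, Real.exp (62 / (p : ℝ) ^ 2) :=
              prod_le_prod (fun _ _ ↦ by positivity) fun p _ ↦ by
                rw [add_comm]; exact Real.add_one_le_exp _
          _ = Real.exp (∑ p ∈ P, 62 / (p : ℝ) ^ 2) := (Real.exp_sum _ _).symm
          _ ≤ Real.exp 124 := by
              gcongr
              calc ∑ p ∈ P, 62 / (p : ℝ) ^ 2 ≤ ∑ p ∈ Icc 1 X, 62 / (p : ℝ) ^ 2 :=
                    sum_le_sum_of_subset_of_nonneg (filter_subset _ _) fun _ _ _ ↦ by positivity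
                _ = 62 * ∑ p ∈ Icc 1 X, 1 / (p : ℝ) ^ 2 := by
                    rw [mul_sum]; exact sum_congr rfl fun _ _ ↦ by ring
                _ ≤ 124 := by linarith [sum_Icc_inv_sq_le X]

end TotientMoments

section PrimeDifferences

open Finset

lemma half_mul_div_log_le_primeCounting {X : ℕ} (hX : 100 ≤ X) :
    (X : ℝ) / (2 * Real.log X) ≤ X.primeCounting := by
  have hX' : (100 : ℝ) ≤ X := by exact_mod_cast hX
  have hlog : 0 < Real.log X := Real.log_pos (by linarith)
  refine le_trans ?_ (Chebyshev.pi_ge X)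
  have h1 : Real.log (X + 1) ≤ (X + 1 : ℝ) / 100 - 1 + 7 * Real.log 2 := by
    have h2 := Real.log_le_sub_one_of_pos (x := (X + 1 : ℝ) / 100) (by positivity)
    rw [Real.log_div (by positivity) (by norm_num)] at h2
    have h3 : Real.log 100 ≤ Real.log ((2 : ℝ) ^ 7) := Real.log_le_log (by norm_num) (by norm_num)
    rw [Real.log_pow] at h3
    push_cast at h3
    linarith
  rw [← div_div]
  gcongr
  nlinarith [Real.log_two_gt_d9, Real.log_two_lt_d9]

/-- The pairs of primes `p < q ≤ X`. -/
def primePairs (X : ℕ) : Finset (ℕ × ℕ) := {x ∈ X.primesLE ×ˢ X.primesLE | x.1 < x.2}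

/-- The positive differences of primes up to `X`. -/
def primeDiffs (X : ℕ) : Finset ℕ := (primePairs X).image fun x ↦ x.2 - x.1

lemma mem_primeDiffs {X h : ℕ} :
    h ∈ primeDiffs X ↔ 0 < h ∧ ∃ p, p.Prime ∧ (p + h).Prime ∧ p + h ≤ X := by
  simp only [primeDiffs, primePairs, mem_image, mem_filter, mem_product, Nat.mem_primesLE,
    Prod.exists]
  constructor
  · rintro ⟨p, q, ⟨⟨⟨-, hp⟩, hqX, hq⟩, hpq⟩, rfl⟩
    exact ⟨by omega, p, hp, by rwa [Nat.add_sub_cancel' hpq.le], by omega⟩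
  · rintro ⟨h0, p, hp, hq, hX⟩
    exact ⟨p, p + h, ⟨⟨⟨by omega, hp⟩, hX, hq⟩, by omega⟩, by omega⟩

lemma primeDiffs_subset (X : ℕ) : primeDiffs X ⊆ Icc 1 X := fun h hh ↦ by
  obtain ⟨h0, p, -, -, hX⟩ := mem_primeDiffs.1 hh
  exact mem_Icc.2 ⟨h0, by omega⟩

lemma card_primePairs_ge (X : ℕ) :
    X.primeCounting * X.primeCounting - X.primeCounting ≤ 2 * #(primePairs X) := by
  rw [← Nat.primesLE_card_eq_primeCounting, ← offDiag_card, two_mul]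
  have hsub : X.primesLE.offDiag ⊆ primePairs X ∪ (primePairs X).image Prod.swap := by
    rintro ⟨p, q⟩ hx
    obtain ⟨hp, hq, hne⟩ := mem_offDiag.1 hx
    simp only [primePairs, mem_union, mem_image, mem_filter, mem_product, Prod.exists,
      Prod.swap_prod_mk, Prod.mk.injEq]
    rcases lt_or_gt_of_ne hne with h | h
    · exact Or.inl ⟨⟨hp, hq⟩, h⟩
    · exact Or.inr ⟨q, p, ⟨⟨hq, hp⟩, h⟩, rfl, rfl⟩
  exact (card_le_card hsub).trans ((card_union_le _ _).trans (Nat.add_le_add_left card_image_le _))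

lemma card_fiber_primePairs_le (X h : ℕ) :
    #{x ∈ primePairs X | x.2 - x.1 = h} ≤ twinCount X h := by
  refine card_le_card_of_injOn Prod.fst (fun x hx ↦ ?_) fun x hx y hy hxy ↦ ?_
  · simp only [primePairs, coe_filter, mem_filter, mem_product, Nat.mem_primesLE] at hx
    obtain ⟨⟨⟨⟨hx1, hx2⟩, hx3, hx4⟩, hlt⟩, rfl⟩ := hx
    refine mem_coe.2 (mem_filter.2 ⟨mem_Icc.2 ⟨hx2.one_le, hx1⟩, hx2, ?_⟩)
    rwa [Nat.add_sub_cancel' hlt.le]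
  · simp only [primePairs, coe_filter, mem_filter] at hx hy
    obtain ⟨⟨-, h1⟩, h2⟩ := hx
    obtain ⟨⟨-, h3⟩, h4⟩ := hy
    exact Prod.ext hxy (by omega)

/-- Differences of primes up to `X` have positive relative density, even when weighted by
`φ(h) / h`. -/
lemma exists_mul_le_sum_primeDiffs : ∃ c : ℝ, 0 < c ∧ ∀ y : ℕ, 2 ≤ y →
    c * (y : ℝ) ^ 16 ≤ ∑ h ∈ primeDiffs (y ^ 16), (h.totient : ℝ) / h := by
  refine ⟨1 / (256 * 10000 ^ 2 * Real.exp 124), by positivity, fun y hy ↦ ?_⟩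
  have htwin := fun h (hh : h ≠ 0) ↦ twinCount_le (h := h) hy hh
  obtain ⟨X, hX⟩ : ∃ X, X = y ^ 16 := ⟨_, rfl⟩
  have hXr : (X : ℝ) = (y : ℝ) ^ 16 := by rw [hX, Nat.cast_pow]
  rw [← hX] at htwin ⊢
  have hX1 : 100 ≤ X := by
    rw [hX]
    calc 100 ≤ 2 ^ 16 := by norm_num
      _ ≤ y ^ 16 := Nat.pow_le_pow_left hy 16
  have hX1' : (100 : ℝ) ≤ X := by exact_mod_cast hX1
  have hlog : 0 < Real.log X := Real.log_pos (by linarith)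
  set Z := (X : ℝ) / Real.log X with hZ
  have hZ0 : 0 < Z := by positivity
  rw [← hXr]
  set S := ∑ h ∈ primeDiffs X, (h.totient : ℝ) / h
  have hS0 : 0 ≤ S := sum_nonneg fun _ _ ↦ by positivity
  have hπ : Z / 2 ≤ X.primeCounting := by
    have := half_mul_div_log_le_primeCounting hX1
    rw [hZ, div_div, mul_comm]; exact this
  have hπ2 : (2 : ℝ) ≤ X.primeCounting := by
    have h3 : (3 : ℕ).primeCounting ≤ X.primeCounting := Nat.monotone_primeCounting (by omega)
    have h3' : (3 : ℕ).primeCounting = 2 := by decide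
    rw [h3'] at h3
    exact_mod_cast h3
  have hW : Z ^ 2 / 16 ≤ (#(primePairs X) : ℝ) := by
    have h1 : (X.primeCounting : ℝ) * X.primeCounting ≤ 2 * #(primePairs X) + X.primeCounting := by
      have := card_primePairs_ge X
      exact_mod_cast Nat.sub_le_iff_le_add.1 this
    nlinarith
  have hpos : ∀ h ∈ primeDiffs X, (0 : ℝ) < h ∧ (0 : ℝ) < h.totient := fun h hh ↦ by
    have := (mem_Icc.1 (primeDiffs_subset X hh)).1
    exact ⟨by exact_mod_cast this, by exact_mod_cast Nat.totient_pos.2 this⟩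
  have hcard : (#(primePairs X) : ℝ) ≤ ∑ h ∈ primeDiffs X, (twinCount X h : ℝ) := by
    rw [card_eq_sum_card_image (fun x : ℕ × ℕ ↦ x.2 - x.1) (primePairs X)]
    exact_mod_cast sum_le_sum fun h _ ↦ card_fiber_primePairs_le X h
  have hCS : (∑ h ∈ primeDiffs X, (twinCount X h : ℝ)) ^ 2 ≤
      S * ∑ h ∈ primeDiffs X, (twinCount X h : ℝ) ^ 2 * (h / h.totient) := by
    refine sum_sq_le_sum_mul_sum_of_sq_le_mul _ (fun _ _ ↦ by positivity)
      (fun _ _ ↦ by positivity) fun h hh ↦ ?_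
    obtain ⟨h1, h2⟩ := hpos h hh
    apply le_of_eq
    field_simp
  have hK : (y : ℝ) ^ 16 / Real.log ((y : ℝ) ^ 16) ^ 2 = Z ^ 2 / X := by
    rw [← hXr, hZ]; field_simp
  have hmom : ∑ h ∈ primeDiffs X, (twinCount X h : ℝ) ^ 2 * (h / h.totient) ≤
      10000 ^ 2 * (Z ^ 2 / X) ^ 2 * (Real.exp 124 * X) := by
    calc _ ≤ ∑ h ∈ primeDiffs X, 10000 ^ 2 * (Z ^ 2 / X) ^ 2 * ((h : ℝ) / h.totient) ^ 5 := by
          refine sum_le_sum fun h hh ↦ ?_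
          have h1 := htwin h (Nat.one_le_iff_ne_zero.1 (mem_Icc.1 (primeDiffs_subset X hh)).1)
          rw [hK] at h1
          calc (twinCount X h : ℝ) ^ 2 * (h / h.totient)
              ≤ (10000 * ((h : ℝ) / h.totient) ^ 2 * (Z ^ 2 / X)) ^ 2 * (h / h.totient) := by
                gcongr
            _ = _ := by ring
      _ = 10000 ^ 2 * (Z ^ 2 / X) ^ 2 * ∑ h ∈ primeDiffs X, ((h : ℝ) / h.totient) ^ 5 := by
          rw [mul_sum]
      _ ≤ _ := by
          gcongr
          exact (sum_le_sum_of_subset_of_nonneg (primeDiffs_subset X) fun _ _ _ ↦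
            by positivity).trans (sum_div_totient_pow_le X)
  have hfin : (Z ^ 2 / 16) ^ 2 ≤ S * (10000 ^ 2 * (Z ^ 2 / X) ^ 2 * (Real.exp 124 * X)) :=
    calc (Z ^ 2 / 16) ^ 2 ≤ (∑ h ∈ primeDiffs X, (twinCount X h : ℝ)) ^ 2 := by
          gcongr; exact hW.trans hcard
      _ ≤ _ := hCS.trans (by gcongr)
  have hX0 : (0 : ℝ) < X := by linarith
  have he := Real.exp_pos 124
  have h1 : S * (10000 ^ 2 * (Z ^ 2 / X) ^ 2 * (Real.exp 124 * X)) =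
      Z ^ 4 * (S * (10000 ^ 2 * Real.exp 124) / X) := by field_simp
  have h2 : (Z ^ 2 / 16) ^ 2 = Z ^ 4 * (1 / 256) := by ring
  rw [h1, h2] at hfin
  have h3 := le_of_mul_le_mul_left hfin (by positivity)
  rw [le_div_iff₀ hX0] at h3
  rw [div_mul_eq_mul_div, div_le_iff₀ (by positivity)]
  linarith

end PrimeDifferences

section SecondMoment

open Finset

/-- The second moment bound for the measure of a finite union. -/
lemma sq_sum_measureReal_le {Ω ι : Type*} [MeasurableSpace Ω] {μ : Measure Ω}
    [IsProbabilityMeasure μ] (I : Finset ι) {A : ι → Set Ω} (hA : ∀ i ∈ I, MeasurableSet (A i))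
    {V : ℝ} (hV0 : 0 < V) (hV : ∑ i ∈ I, ∑ j ∈ I, μ.real (A i ∩ A j) ≤ V) :
    (∑ i ∈ I, μ.real (A i)) ^ 2 ≤ V * μ.real (⋃ i ∈ I, A i) := by
  set U := ⋃ i ∈ I, A i
  set S := ∑ i ∈ I, μ.real (A i)
  have hU : MeasurableSet U := Finset.measurableSet_biUnion I hA
  set f : Ω → ℝ := fun x ↦ ∑ i ∈ I, (A i).indicator 1 x with hf
  have hind : ∀ {B : Set Ω}, MeasurableSet B → Integrable (B.indicator (1 : Ω → ℝ)) μ :=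
    fun hB ↦ (integrable_const (1 : ℝ)).indicator hB
  have hfi : Integrable f μ := integrable_finsetSum _ fun i hi ↦ hind (hA i hi)
  have hf2 : ∀ x, f x ^ 2 = ∑ i ∈ I, ∑ j ∈ I, (A i ∩ A j).indicator 1 x := fun x ↦ by
    simp only [hf, sq, sum_mul_sum, Set.inter_indicator_one, Pi.mul_apply]
  have hf2i : Integrable (fun x ↦ f x ^ 2) μ := by
    simp only [hf2]
    exact integrable_finsetSum _ fun i hi ↦ integrable_finsetSum _ fun j hj ↦
      hind ((hA i hi).inter (hA j hj))
  have h1 : ∫ x, f x ∂μ = S := by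
    rw [integral_finsetSum _ fun i hi ↦ hind (hA i hi)]
    exact sum_congr rfl fun i hi ↦ integral_indicator_one (hA i hi)
  have h2 : ∫ x, f x ^ 2 ∂μ ≤ V := by
    refine le_trans (le_of_eq ?_) hV
    simp only [hf2]
    rw [integral_finsetSum _ fun i hi ↦ integrable_finsetSum _ fun j hj ↦
      hind ((hA i hi).inter (hA j hj))]
    refine sum_congr rfl fun i hi ↦ ?_
    rw [integral_finsetSum _ fun j hj ↦ hind ((hA i hi).inter (hA j hj))]
    exact sum_congr rfl fun j hj ↦ integral_indicator_one ((hA i hi).inter (hA j hj))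
  set t := S / V with ht
  have hpt : ∀ x, 2 * t * f x - t ^ 2 * f x ^ 2 ≤ U.indicator 1 x := fun x ↦ by
    by_cases hx : x ∈ U
    · rw [Set.indicator_of_mem hx, Pi.one_apply]; nlinarith [sq_nonneg (t * f x - 1)]
    · have h0 : f x = 0 := sum_eq_zero fun i hi ↦
        Set.indicator_of_notMem (fun h ↦ hx (Set.mem_biUnion hi h)) _
      rw [Set.indicator_of_notMem hx, h0]; simp
  have h3 := integral_mono ((hfi.const_mul (2 * t)).sub (hf2i.const_mul (t ^ 2))) (hind hU) hpt
  simp only [Pi.sub_apply] at h3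
  rw [integral_sub (hfi.const_mul _) (hf2i.const_mul _), integral_const_mul, integral_const_mul,
    h1, integral_indicator_one hU] at h3
  have h4 : 2 * t * S - t ^ 2 * V ≤ μ.real U := by nlinarith [sq_nonneg t]
  have h5 : 2 * t * S - t ^ 2 * V = S ^ 2 / V := by rw [ht]; field_simp; ring
  rw [h5, div_le_iff₀ hV0] at h4
  linarith

end SecondMoment

section TorsionPoints

open Finset UnitAddCircle

lemma exists_real_lift (w : UnitAddCircle) : ∃ x : ℝ, (x : UnitAddCircle) = w ∧ |x| = ‖w‖ := by
  obtain ⟨x, rfl⟩ := QuotientAddGroup.mk_surjective w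
  refine ⟨x - round x, ?_, (UnitAddCircle.norm_eq).symm⟩
  rw [AddCircle.coe_sub, sub_eq_self]
  exact (AddCircle.coe_eq_zero_iff (1 : ℝ)).2 ⟨round x, by simp⟩

/-- There are at most `2 Δ l` nonzero `l`-torsion points of norm less than `Δ`. -/
lemma ncard_small_torsion_le {l : ℕ} (hl : 0 < l) {Δ : ℝ} (hΔ : 0 ≤ Δ) :
    ({w : UnitAddCircle | l • w = 0 ∧ w ≠ 0 ∧ ‖w‖ < Δ}.ncard : ℝ) ≤ 2 * Δ * l := by
  have hl' : (0 : ℝ) < l := by exact_mod_cast hl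
  set J := ⌊Δ * l⌋₊
  have hsub : {w : UnitAddCircle | l • w = 0 ∧ w ≠ 0 ∧ ‖w‖ < Δ} ⊆
      (((Icc (-(J : ℤ)) J).erase 0).image fun j : ℤ ↦ ((j / l : ℝ) : UnitAddCircle) :
        Finset UnitAddCircle) := by
    rintro w ⟨hw, hw0, hwΔ⟩
    obtain ⟨x, rfl, hx⟩ := exists_real_lift w
    rw [← AddCircle.coe_nsmul, AddCircle.coe_eq_zero_iff] at hw
    obtain ⟨j, hj⟩ := hw
    have hj' : (j : ℝ) = l * x := by simpa using hj
    have hx' : x = j / l := by rw [hj']; field_simp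
    refine mem_coe.2 (mem_image.2 ⟨j, mem_erase.2 ⟨?_, ?_⟩, by rw [hx']⟩)
    · rintro rfl
      apply hw0
      rw [hx']; simp
    · have hjJ : (j.natAbs : ℝ) ≤ Δ * l := by
        rw [Nat.cast_natAbs, Int.cast_abs, hj', abs_mul, abs_of_pos hl', hx, mul_comm]
        gcongr
      have := Nat.le_floor hjJ
      rw [mem_Icc]
      omega
  have h1 := Set.ncard_le_ncard hsub (Finset.finite_toSet _)
  rw [Set.ncard_coe_finset] at h1
  have h2 := h1.trans card_image_le
  rw [card_erase_of_mem (by simp), Int.card_Icc] at h2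
  have h3 : {w : UnitAddCircle | l • w = 0 ∧ w ≠ 0 ∧ ‖w‖ < Δ}.ncard ≤ 2 * J := by omega
  calc _ ≤ ((2 * J : ℕ) : ℝ) := by exact_mod_cast h3
    _ = 2 * J := by push_cast; rfl
    _ ≤ 2 * (Δ * l) := by gcongr; exact Nat.floor_le (by positivity)
    _ = _ := by ring

/-- The points of order `n` of the circle, for `n ≠ 0`. -/
noncomputable def orderPoints (n : ℕ) : Finset UnitAddCircle :=
  if hn : 0 < n then (AddCircle.finite_setOfPred_addOrderOf_eq (1 : ℝ) hn).toFinset else ∅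

lemma mem_orderPoints {n : ℕ} (hn : 0 < n) {u : UnitAddCircle} :
    u ∈ orderPoints n ↔ addOrderOf u = n := by
  simp [orderPoints, hn]

lemma card_orderPoints {n : ℕ} (hn : 0 < n) : #(orderPoints n) = n.totient := by
  rw [← AddCircle.card_addOrderOf_eq_totient (p := (1 : ℝ)), orderPoints, dif_pos hn,
    ← Set.ncard_eq_toFinset_card _ (AddCircle.finite_setOfPred_addOrderOf_eq (1 : ℝ) hn)]
  rfl

lemma card_close_pairs_le {q r : ℕ} (hq : 0 < q) (hr : 0 < r) {Δ : ℝ} (hΔ : 0 ≤ Δ) :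
    (#{x ∈ orderPoints q ×ˢ orderPoints r | x.1 ≠ x.2 ∧ ‖x.1 - x.2‖ < Δ} : ℝ) ≤
      2 * Δ * (q * r) := by
  classical
  set s := {x ∈ orderPoints q ×ˢ orderPoints r | x.1 ≠ x.2 ∧ ‖x.1 - x.2‖ < Δ}
  set d : UnitAddCircle × UnitAddCircle → UnitAddCircle := fun x ↦ x.1 - x.2 with hd
  have hg : 0 < q.gcd r := Nat.gcd_pos_of_pos_left _ hq
  have hmem : ∀ x ∈ s, q • x.1 = 0 ∧ r • x.2 = 0 ∧ x.1 ≠ x.2 ∧ ‖x.1 - x.2‖ < Δ := fun x hx ↦ by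
    obtain ⟨hx1, hx2, hx3⟩ := mem_filter.1 hx
    obtain ⟨h1, h2⟩ := mem_product.1 hx1
    rw [mem_orderPoints hq] at h1
    rw [mem_orderPoints hr] at h2
    exact ⟨h1 ▸ addOrderOf_nsmul_eq_zero _, h2 ▸ addOrderOf_nsmul_eq_zero _, hx2, hx3⟩
  have hfib : ∀ w ∈ s.image d, #{x ∈ s | d x = w} ≤ q.gcd r := by
    intro w hw
    obtain ⟨x₀, hx₀, rfl⟩ := mem_image.1 hw
    have htor : {u : UnitAddCircle | q.gcd r • u = 0}.Finite := AddCircle.finite_torsion 1 hg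
    have hcard : htor.toFinset.card ≤ q.gcd r := by
      have h1 := AddCircle.card_torsion_le_of_isSMulRegular (1 : ℝ) (q.gcd r) hg.ne'
        (.of_right_eq_zero_of_smul fun _ ↦ by simp [hg.ne'])
      rw [htor.encard_eq_coe_toFinset_card] at h1
      exact_mod_cast h1
    refine (card_le_card_of_injOn (fun x ↦ x.1 - x₀.1) (fun x hx ↦ ?_) fun x hx y hy hxy ↦ ?_).trans
      hcard
    · obtain ⟨hxs, hxd⟩ := mem_filter.1 (mem_coe.1 hx)
      obtain ⟨h1, h2, -⟩ := hmem x hxs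
      obtain ⟨h3, h4, -⟩ := hmem x₀ hx₀
      have heq : x.1 - x₀.1 = x.2 - x₀.2 := by
        have : x.1 - x.2 = x₀.1 - x₀.2 := hxd
        rw [sub_eq_sub_iff_add_eq_add] at this ⊢
        rw [this, add_comm]
      simp only [Set.Finite.coe_toFinset, Set.mem_ofPred_eq]
      rw [← addOrderOf_dvd_iff_nsmul_eq_zero]
      refine Nat.dvd_gcd (addOrderOf_dvd_iff_nsmul_eq_zero.2 ?_)
        (addOrderOf_dvd_iff_nsmul_eq_zero.2 ?_)
      · rw [nsmul_sub, h1, h3, sub_zero]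
      · rw [heq, nsmul_sub, h2, h4, sub_zero]
    · have hx2 := (mem_filter.1 (mem_coe.1 hx)).2
      have hy2 := (mem_filter.1 (mem_coe.1 hy)).2
      have h1 : x.1 = y.1 := sub_left_injective hxy
      have h2 : x.1 - x.2 = y.1 - y.2 := hx2.trans hy2.symm
      rw [h1] at h2
      exact Prod.ext h1 (sub_right_injective h2)
  have hl : 0 < q.lcm r := Nat.lcm_pos hq hr
  have himg : ((s.image d).card : ℝ) ≤ 2 * Δ * (q.lcm r : ℕ) := by
    refine le_trans ?_ (ncard_small_torsion_le hl hΔ)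
    rw [← Set.ncard_coe_finset]
    refine Nat.cast_le.2 (Set.ncard_le_ncard ?_
      ((AddCircle.finite_torsion (1 : ℝ) hl).subset fun w hw ↦ hw.1))
    intro w hw
    obtain ⟨x, hx, rfl⟩ := mem_image.1 (mem_coe.1 hw)
    obtain ⟨h1, h2, h3, h4⟩ := hmem x hx
    refine ⟨?_, sub_ne_zero.2 h3, h4⟩
    rw [hd, nsmul_sub, sub_eq_zero]
    obtain ⟨a, ha⟩ := Nat.dvd_lcm_left q r
    obtain ⟨b, hb⟩ := Nat.dvd_lcm_right q r
    rw [ha, mul_nsmul, h1, nsmul_zero, ← ha, hb, mul_nsmul, h2, nsmul_zero]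
  calc (#s : ℝ) ≤ ((q.gcd r * #(s.image d) : ℕ) : ℝ) :=
        Nat.cast_le.2 (card_le_mul_card_image s _ hfib)
    _ ≤ q.gcd r * (2 * Δ * (q.lcm r : ℕ)) := by push_cast; gcongr
    _ = 2 * Δ * ((q.gcd r * q.lcm r : ℕ) : ℝ) := by push_cast; ring
    _ = _ := by rw [Nat.gcd_mul_lcm]; push_cast; rfl

end TorsionPoints

section DuffinSchaeffer

open Finset

lemma measureReal_ball_eq {u : UnitAddCircle} {ε : ℝ} (h0 : 0 ≤ ε) (h : ε ≤ 1 / 2) :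
    volume.real (Metric.ball u ε) = 2 * ε := by
  rw [← measureReal_congr AddCircle.closedBall_ae_eq_ball, measureReal_def,
    AddCircle.volume_closedBall, min_eq_right (by linarith), ENNReal.toReal_ofReal (by linarith)]

lemma measureReal_ball_inter_ball_le {u v : UnitAddCircle} {ε η : ℝ} (hε0 : 0 ≤ ε)
    (hε : ε ≤ 1 / 2) (hη0 : 0 ≤ η) (hη : η ≤ 1 / 2) :
    volume.real (Metric.ball u ε ∩ Metric.ball v η) ≤ (if u = v then 2 * ε else 0) +
      if u ≠ v ∧ ‖u - v‖ < 2 * max ε η then 2 * min ε η else 0 := by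
  have h1 : volume.real (Metric.ball u ε ∩ Metric.ball v η) ≤ 2 * ε :=
    (measureReal_mono Set.inter_subset_left).trans (measureReal_ball_eq hε0 hε).le
  have h2 : volume.real (Metric.ball u ε ∩ Metric.ball v η) ≤ 2 * η :=
    (measureReal_mono Set.inter_subset_right).trans (measureReal_ball_eq hη0 hη).le
  by_cases huv : u = v
  · simpa [huv] using huv ▸ h1
  rw [if_neg huv, zero_add]
  split_ifs with h
  · rcases le_total ε η with hle | hle
    · rwa [min_eq_left hle]
    · rwa [min_eq_right hle]
  · have hdist : ε + η ≤ dist u v := by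
      have : 2 * max ε η ≤ ‖u - v‖ := not_lt.1 fun hlt ↦ h ⟨huv, hlt⟩
      rw [dist_eq_norm]
      linarith [le_max_left ε η, le_max_right ε η]
    rw [(Metric.ball_disjoint_ball hdist).inter_eq, measureReal_empty]

lemma sum_measureReal_inter_le {q r : ℕ} (hq : 0 < q) (hr : 0 < r) {ε η : ℝ} (hε0 : 0 ≤ ε)
    (hε : ε ≤ 1 / 2) (hη0 : 0 ≤ η) (hη : η ≤ 1 / 2) :
    ∑ u ∈ orderPoints q, ∑ v ∈ orderPoints r, volume.real (Metric.ball u ε ∩ Metric.ball v η) ≤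
      (if q = r then 2 * (q.totient * ε) else 0) + 8 * (q * ε) * (r * η) := by
  calc _ ≤ ∑ u ∈ orderPoints q, ∑ v ∈ orderPoints r, ((if u = v then 2 * ε else 0) +
      if u ≠ v ∧ ‖u - v‖ < 2 * max ε η then 2 * min ε η else 0) :=
        sum_le_sum fun u _ ↦ sum_le_sum fun v _ ↦
          measureReal_ball_inter_ball_le hε0 hε hη0 hη
    _ = ∑ u ∈ orderPoints q, ∑ v ∈ orderPoints r, (if u = v then 2 * ε else 0) +
        ∑ u ∈ orderPoints q, ∑ v ∈ orderPoints r,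
          if u ≠ v ∧ ‖u - v‖ < 2 * max ε η then 2 * min ε η else 0 := by
        simp only [sum_add_distrib]
    _ ≤ _ := by
        refine add_le_add ?_ ?_
        · split_ifs with hqr
          · subst hqr
            refine le_of_eq ?_
            simp only [sum_ite_eq]
            rw [sum_congr rfl fun u hu ↦ if_pos hu, sum_const, card_orderPoints hq, nsmul_eq_mul]
            ring
          · refine (sum_eq_zero fun u hu ↦ sum_eq_zero fun v hv ↦ if_neg ?_).le
            rintro rfl
            exact hqr (((mem_orderPoints hq).1 hu).symm.trans ((mem_orderPoints hr).1 hv))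
        · rw [← sum_product', ← sum_filter, sum_const, nsmul_eq_mul]
          have hΔ : 0 ≤ 2 * max ε η := by positivity
          have hmin : 0 ≤ 2 * min ε η := by positivity
          refine (mul_le_mul_of_nonneg_right (card_close_pairs_le hq hr hΔ) hmin).trans_eq ?_
          have h := min_mul_max ε η
          linear_combination 8 * (q : ℝ) * r * h

lemma le_measureReal_biUnion_approxAddOrderOf {δ : ℕ → ℝ} {s : Finset ℕ} {c : ℝ} (hc : 0 ≤ c)
    (hs : ∀ n ∈ s, 0 < n ∧ 0 ≤ δ n ∧ δ n ≤ 1 / 2) (h1 : 1 ≤ ∑ n ∈ s, n * δ n)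
    (hcs : c * ∑ n ∈ s, n * δ n ≤ ∑ n ∈ s, n.totient * δ n) :
    c ^ 2 / 5 ≤ volume.real (⋃ n ∈ s, approxAddOrderOf UnitAddCircle n (δ n)) := by
  set T := ∑ n ∈ s, n * δ n with hT
  set P := ∑ n ∈ s, n.totient * δ n with hP
  have hPT : P ≤ T := sum_le_sum fun n hn ↦
    mul_le_mul_of_nonneg_right (Nat.cast_le.2 (Nat.totient_le n)) (hs n hn).2.1
  let I : Finset (Σ _ : ℕ, UnitAddCircle) := s.sigma fun n ↦ orderPoints n
  let A : (Σ _ : ℕ, UnitAddCircle) → Set UnitAddCircle := fun i ↦ Metric.ball i.2 (δ i.1)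
  have hS : ∑ i ∈ I, volume.real (A i) = 2 * P := by
    rw [sum_sigma, hP, mul_sum]
    refine sum_congr rfl fun n hn ↦ ?_
    obtain ⟨hn0, hδ0, hδ1⟩ := hs n hn
    rw [sum_congr rfl fun u _ ↦ measureReal_ball_eq hδ0 hδ1, sum_const, card_orderPoints hn0,
      nsmul_eq_mul]
    ring
  have hV : ∑ i ∈ I, ∑ j ∈ I, volume.real (A i ∩ A j) ≤ 10 * T ^ 2 := by
    calc ∑ i ∈ I, ∑ j ∈ I, volume.real (A i ∩ A j)
        = ∑ q ∈ s, ∑ r ∈ s, ∑ u ∈ orderPoints q, ∑ v ∈ orderPoints r,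
            volume.real (Metric.ball u (δ q) ∩ Metric.ball v (δ r)) := by
          rw [sum_sigma]
          refine sum_congr rfl fun q _ ↦ ?_
          rw [sum_comm, sum_sigma]
          exact sum_congr rfl fun r _ ↦ sum_comm
      _ ≤ ∑ q ∈ s, ∑ r ∈ s, ((if q = r then 2 * (q.totient * δ q) else 0) +
            8 * (q * δ q) * (r * δ r)) :=
          sum_le_sum fun q hq ↦ sum_le_sum fun r hr ↦ sum_measureReal_inter_le (hs q hq).1
            (hs r hr).1 (hs q hq).2.1 (hs q hq).2.2 (hs r hr).2.1 (hs r hr).2.2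
      _ = 2 * P + 8 * T * T := by
          simp only [sum_add_distrib, sum_ite_eq]
          congr 1
          · rw [sum_congr rfl fun u hu ↦ if_pos hu, ← mul_sum]
          · rw [mul_assoc, hT, sum_mul_sum, mul_sum]
            refine sum_congr rfl fun q _ ↦ ?_
            rw [mul_sum]
            exact sum_congr rfl fun r _ ↦ by ring
      _ ≤ 10 * T ^ 2 := by nlinarith
  have : IsProbabilityMeasure (volume : Measure UnitAddCircle) := ⟨UnitAddCircle.measure_univ⟩
  have hmain := sq_sum_measureReal_le I (A := A) (fun _ _ ↦ Metric.isOpen_ball.measurableSet)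
    (by positivity) hV
  have hsub : ⋃ i ∈ I, A i ⊆ ⋃ n ∈ s, approxAddOrderOf UnitAddCircle n (δ n) := by
    refine Set.iUnion₂_subset fun i hi x hx ↦ ?_
    obtain ⟨hi1, hi2⟩ := mem_sigma.1 hi
    refine Set.mem_biUnion hi1 (mem_approx_add_orderOf_iff.2 ⟨i.2, ?_, hx⟩)
    exact (mem_orderPoints (hs _ hi1).1).1 hi2
  refine le_trans ?_ (measureReal_mono hsub (measure_ne_top _ _))
  rw [hS] at hmain
  have h2 : (2 * (c * T)) ^ 2 ≤ (2 * P) ^ 2 := by gcongr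
  have h3 : T ^ 2 * (4 * c ^ 2) ≤ T ^ 2 * (10 * volume.real (⋃ i ∈ I, A i)) := by nlinarith
  have h4 := le_of_mul_le_mul_left h3 (by positivity)
  nlinarith [sq_nonneg c]

/-- A form of the Duffin–Schaeffer theorem. -/
theorem ae_mem_addWellApproximable {δ : ℕ → ℝ} (hδ0 : ∀ n, 0 ≤ δ n)
    (hδ : Tendsto δ atTop (nhds 0)) {c : ℝ} (hc : 0 < c)
    (h : ∀ m, ∃ s : Finset ℕ, (∀ n ∈ s, m ≤ n ∧ 0 < n) ∧ 1 ≤ ∑ n ∈ s, n * δ n ∧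
      c * ∑ n ∈ s, n * δ n ≤ ∑ n ∈ s, n.totient * δ n) :
    ∀ᵐ x, x ∈ addWellApproximable UnitAddCircle δ := by
  refine (AddCircle.addWellApproximable_ae_empty_or_univ δ hδ).resolve_left fun hempty ↦ ?_
  rw [← measure_eq_zero_iff_ae_notMem] at hempty
  set B : ℕ → Set UnitAddCircle := fun i ↦
    ⋃ n, ⋃ (_ : 0 < n ∧ i ≤ n), approxAddOrderOf UnitAddCircle n (δ n) with hB
  have hlim : addWellApproximable UnitAddCircle δ = ⋂ i, B i := by
    rw [addWellApproximable, blimsup_eq_iInf_biSup_of_nat]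
    rfl
  have hmeas : ∀ i, MeasurableSet (B i) := fun i ↦
    (isOpen_iUnion fun n ↦ isOpen_iUnion fun _ ↦ Metric.isOpen_thickening).measurableSet
  have hanti : Antitone B := fun i j hij ↦
    Set.iUnion_mono fun n ↦ Set.iUnion_mono' fun hn ↦ ⟨⟨hn.1, hij.trans hn.2⟩, subset_rfl⟩
  obtain ⟨m, hm⟩ := eventually_atTop.1 (hδ.eventually (ge_mem_nhds (by norm_num : (0 : ℝ) < 1 / 2)))
  have hlow : ∀ i, ENNReal.ofReal (c ^ 2 / 5) ≤ volume (B i) := fun i ↦ by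
    obtain ⟨s, hs, hs1, hs2⟩ := h (max i m)
    have h1 := le_measureReal_biUnion_approxAddOrderOf hc.le (fun n hn ↦
      ⟨(hs n hn).2, hδ0 n, hm n ((le_max_right _ _).trans (hs n hn).1)⟩) hs1 hs2
    refine (ENNReal.ofReal_le_ofReal h1).trans ?_
    rw [measureReal_def, ENNReal.ofReal_toReal (measure_ne_top _ _)]
    refine measure_mono (Set.iUnion_mono fun n ↦ Set.iUnion_mono' fun hn ↦ ⟨?_, subset_rfl⟩)
    exact ⟨(hs n hn).2, (le_max_left _ _).trans (hs n hn).1⟩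
  have htend := tendsto_measure_iInter_atTop (μ := volume)
    (fun i ↦ (hmeas i).nullMeasurableSet) hanti ⟨0, measure_ne_top _ _⟩
  rw [← hlim, hempty] at htend
  have h0 : ENNReal.ofReal (c ^ 2 / 5) ≤ 0 := ge_of_tendsto' htend hlow
  rw [nonpos_iff_eq_zero, ENNReal.ofReal_eq_zero] at h0
  nlinarith [pow_pos hc 2]

end DuffinSchaeffer

section IteratedLog

open Finset

lemma one_le_L (x : ℝ) : 1 ≤ L x := le_max_left _ _

lemma L_mono {x y : ℝ} (hx : 0 < x) (hxy : x ≤ y) : L x ≤ L y :=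
  max_le_max_left _ (Real.log_le_log hx hxy)

lemma L_mul_le {B x : ℝ} (hB : 1 ≤ B) (hx : 0 < x) : L (B * x) ≤ (1 + Real.log B) * L x := by
  have h1 := one_le_L x
  have h2 : Real.log x ≤ L x := le_max_right _ _
  have h3 := Real.log_nonneg hB
  refine max_le (by nlinarith) ?_
  rw [Real.log_mul (by positivity) hx.ne']
  nlinarith

lemma L_sub_le {x y : ℝ} (hx : 0 < x) (hxy : x ≤ y) : L y - L x ≤ (y - x) / x := by
  have h1 : Real.log y - Real.log x ≤ (y - x) / x := by
    rw [← Real.log_div (by linarith) hx.ne', sub_div, div_self hx.ne']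
    exact Real.log_le_sub_one_of_pos (div_pos (by linarith) hx)
  have h2 : Real.log x ≤ L x := le_max_right _ _
  have h3 := one_le_L x
  have h4 : 0 ≤ (y - x) / x := div_nonneg (by linarith) hx.le
  rw [sub_le_iff_le_add]
  exact max_le (by linarith) (by linarith)

lemma log_LL_succ_sub_le {k : ℕ} (hk : 1 ≤ k) :
    Real.log (LL (k + 1 : ℕ)) - Real.log (LL k) ≤ 1 / (k * L k * LL k) := by
  have hk0 : (0 : ℝ) < k := by exact_mod_cast hk
  have hkk : (k : ℝ) ≤ (k + 1 : ℕ) := by push_cast; linarith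
  have hL := one_le_L k
  have hLL : 1 ≤ LL k := one_le_L _
  have hLm := L_mono hk0 hkk
  have hLLm : LL k ≤ LL (k + 1 : ℕ) := L_mono (by linarith) hLm
  have h1 : L (k + 1 : ℕ) - L k ≤ 1 / k := by
    refine (L_sub_le hk0 hkk).trans_eq ?_
    push_cast; ring
  have h2 : LL (k + 1 : ℕ) - LL k ≤ 1 / k / L k :=
    (L_sub_le (by linarith) hLm).trans (by gcongr)
  rw [← Real.log_div (by linarith) (by linarith)]
  calc _ ≤ LL (k + 1 : ℕ) / LL k - 1 :=
        Real.log_le_sub_one_of_pos (div_pos (by linarith) (by linarith))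
    _ = (LL (k + 1 : ℕ) - LL k) / LL k := by rw [sub_div, div_self (by linarith)]
    _ ≤ 1 / k / L k / LL k := by gcongr
    _ = _ := by rw [div_div, div_div, mul_assoc]

lemma log_LL_sub_le_sum {m n : ℕ} (hm : 1 ≤ m) (hmn : m ≤ n) :
    Real.log (LL n) - Real.log (LL m) ≤ ∑ k ∈ Ico m n, 1 / ((k : ℝ) * L k * LL k) := by
  induction n, hmn using Nat.le_induction with
  | base => simp
  | succ n hmn ih =>
    rw [sum_Ico_succ_top hmn]
    linarith [log_LL_succ_sub_le (hm.trans hmn)]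

lemma exists_le_sum_inv_mul_L_mul_LL {m : ℕ} (hm : 1 ≤ m) (K : ℝ) :
    ∃ n, m ≤ n ∧ K ≤ ∑ k ∈ Ico m n, 1 / ((k : ℝ) * L k * LL k) := by
  have hlog : Tendsto (fun n : ℕ ↦ Real.log (Real.log (Real.log n))) atTop atTop :=
    Real.tendsto_log_atTop.comp (Real.tendsto_log_atTop.comp
      (Real.tendsto_log_atTop.comp tendsto_natCast_atTop_atTop))
  have hlog2 : Tendsto (fun n : ℕ ↦ Real.log (Real.log n)) atTop atTop :=
    Real.tendsto_log_atTop.comp (Real.tendsto_log_atTop.comp tendsto_natCast_atTop_atTop)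
  have hlog1 : Tendsto (fun n : ℕ ↦ Real.log n) atTop atTop :=
    Real.tendsto_log_atTop.comp tendsto_natCast_atTop_atTop
  obtain ⟨n, hmn, h1, h2, h3⟩ := ((eventually_ge_atTop m).and ((hlog1.eventually_gt_atTop 0).and
    ((hlog2.eventually_gt_atTop 0).and
      (hlog.eventually_ge_atTop (K + Real.log (LL m)))))).exists
  refine ⟨n, hmn, le_trans ?_ (log_LL_sub_le_sum hm hmn)⟩
  have h4 : Real.log (Real.log n) ≤ LL n :=
    (Real.log_le_log h1 (le_max_right _ _)).trans (le_max_right _ _)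
  have h5 := Real.log_le_log h2 h4
  linarith

end IteratedLog

section PrimeGaps

open Finset

/-- The approximation threshold `1 / (N (log N)² log₂ N log₃ N)`. -/
noncomputable def gapThreshold (N : ℕ) : ℝ := 1 / ((N : ℝ) * (L N) ^ 2 * LL N * LLL N)

lemma gapThreshold_nonneg (N : ℕ) : 0 ≤ gapThreshold N := by
  have h2 : 0 ≤ LL N := zero_le_one.trans (one_le_L _)
  have h3 : 0 ≤ LLL N := zero_le_one.trans (one_le_L _)
  unfold gapThreshold
  positivity

lemma gapThreshold_le_one (N : ℕ) : gapThreshold N ≤ 1 := by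
  rcases Nat.eq_zero_or_pos N with rfl | hN
  · simp [gapThreshold]
  have hN' : (1 : ℝ) ≤ N := by exact_mod_cast hN
  have h1 : 1 ≤ L N := one_le_L _
  have h2 : 1 ≤ LL N := one_le_L _
  have h3 : 1 ≤ LLL N := one_le_L _
  refine div_le_one_of_le₀ ?_ (by positivity)
  exact one_le_mul_of_one_le_of_one_le (one_le_mul_of_one_le_of_one_le
    (one_le_mul_of_one_le_of_one_le hN' (one_le_pow₀ h1)) h2) h3

lemma le_mul_gapThreshold {k N : ℕ} {Y B C : ℝ} (hk : 1 ≤ k) (hN : 1 ≤ N) (hC : 0 < C) (hB : 1 ≤ B)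
    (hlog : Real.log N ≤ k * B) (hNY : N ≤ C * (Y / k)) :
    1 / (C * B ^ 2 * (1 + Real.log B) * (1 + Real.log (1 + Real.log B))) *
      (1 / (k * L k * LL k)) ≤ Y * gapThreshold N := by
  have hk' : (1 : ℝ) ≤ k := by exact_mod_cast hk
  have hN' : (1 : ℝ) ≤ N := by exact_mod_cast hN
  have hB1 := Real.log_nonneg hB
  have hB2 : 0 ≤ Real.log (1 + Real.log B) := Real.log_nonneg (by linarith)
  have hL : L N ≤ B * k := max_le (one_le_mul_of_one_le_of_one_le hB hk') (by linarith)
  have hL1 : 1 ≤ L N := one_le_L _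
  have hLk : 1 ≤ L k := one_le_L _
  have hLLk : 1 ≤ LL k := one_le_L _
  have hLL : LL N ≤ (1 + Real.log B) * L k :=
    (L_mono (by linarith) hL).trans (L_mul_le hB (by linarith))
  have hLL1 : 1 ≤ LL N := one_le_L _
  have hLLL : LLL N ≤ (1 + Real.log (1 + Real.log B)) * LL k :=
    (L_mono (by linarith) hLL).trans (L_mul_le (by linarith) (by linarith))
  have hLLL1 : 1 ≤ LLL N := one_le_L _
  have hY : 0 < Y := by
    by_contra hY
    have : C * (Y / k) ≤ 0 := mul_nonpos_of_nonneg_of_nonpos hC.le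
      (div_nonpos_of_nonpos_of_nonneg (not_lt.1 hY) (by linarith))
    linarith
  rw [gapThreshold, div_mul_div_comm, one_mul, mul_one_div Y,
    div_le_div_iff₀ (by positivity) (by positivity), one_mul]
  calc (N : ℝ) * L N ^ 2 * LL N * LLL N
      ≤ (C * (Y / k)) * (B * k) ^ 2 * ((1 + Real.log B) * L k) *
        ((1 + Real.log (1 + Real.log B)) * LL k) := by gcongr
    _ = _ := by field_simp

lemma deltaMin_le_of_mem_primeDiffs {X h : ℕ} (hh : h ∈ primeDiffs X) (α : ℝ) :
    deltaMin nthPrime α X.primeCounting ≤ nint (h * α) := by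
  obtain ⟨h0, p, hp, hq, hX⟩ := mem_primeDiffs.1 hh
  have hidx : ∀ {q : ℕ}, q.Prime → nthPrime (q.primeCounting' + 1) = q := fun hq ↦ by
    rw [nthPrime, Nat.add_sub_cancel]
    exact Nat.nth_count hq
  have hle : ∀ {q : ℕ}, q.Prime → q ≤ X → q.primeCounting' + 1 ≤ X.primeCounting := fun hq hqX ↦ by
    refine le_trans (le_of_eq ?_) (Nat.monotone_primeCounting hqX)
    rw [Nat.primeCounting, Nat.primeCounting', Nat.count_succ, if_pos hq]
  refine csInf_le ⟨0, ?_⟩ ⟨(p + h).primeCounting' + 1, p.primeCounting' + 1, by omega, hle hq hX,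
    by omega, hle hp (by omega), fun heq ↦ ?_, ?_⟩
  · rintro x ⟨m, n, -, -, -, -, -, rfl⟩
    exact abs_nonneg _
  · have := congrArg nthPrime heq
    rw [hidx hq, hidx hp] at this
    omega
  · rw [hidx hq, hidx hp]
    push_cast
    ring_nf

/-- The approximation function whose mass on the `k`-th block `(M ^ (k - 1), M ^ k]` sits on the
differences of primes up to `M ^ k`. -/
noncomputable def diffApprox (M h : ℕ) : ℝ :=
  if h ∈ primeDiffs (M ^ Nat.clog M h) then
    gapThreshold (M ^ Nat.clog M h).primeCounting / h else 0

lemma diffApprox_nonneg (M h : ℕ) : 0 ≤ diffApprox M h := by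
  unfold diffApprox
  split_ifs
  · exact div_nonneg (gapThreshold_nonneg _) (Nat.cast_nonneg _)
  · rfl

lemma tendsto_diffApprox (M : ℕ) : Tendsto (diffApprox M) atTop (nhds 0) := by
  refine squeeze_zero (diffApprox_nonneg M) (fun h ↦ ?_) tendsto_one_div_atTop_nhds_zero_nat
  unfold diffApprox
  split_ifs
  · gcongr
    exact gapThreshold_le_one _
  · positivity

/-- The differences of primes up to `M ^ k` in the `k`-th block. -/
def diffBlock (M k : ℕ) : Finset ℕ := {h ∈ primeDiffs (M ^ k) | Nat.clog M h = k}

lemma sum_diffBlock_mul_diffApprox (M k : ℕ) (f : ℕ → ℝ) :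
    ∑ h ∈ diffBlock M k, f h * diffApprox M h =
      gapThreshold (M ^ k).primeCounting * ∑ h ∈ diffBlock M k, f h / h := by
  rw [mul_sum]
  refine sum_congr rfl fun h hh ↦ ?_
  obtain ⟨h1, h2⟩ := mem_filter.1 hh
  rw [diffApprox, h2, if_pos h1]
  ring

lemma sum_diffBlock_ge {M k : ℕ} (hM : 1 < M) (hk : 1 ≤ k) :
    ∑ h ∈ primeDiffs (M ^ k), (h.totient : ℝ) / h - (M : ℝ) ^ (k - 1) ≤
      ∑ h ∈ diffBlock M k, (h.totient : ℝ) / h := by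
  rw [diffBlock, sub_le_iff_le_add, ← sum_filter_add_sum_filter_not _ fun h ↦ Nat.clog M h = k]
  gcongr
  calc _ ≤ ∑ h ∈ Icc 1 (M ^ (k - 1)), (1 : ℝ) := by
        refine (sum_le_sum_of_subset_of_nonneg (fun h hh ↦ ?_) fun _ _ _ ↦ by positivity).trans
          (sum_le_sum fun h _ ↦ div_le_one_of_le₀ (Nat.cast_le.2 (Nat.totient_le h))
            (Nat.cast_nonneg h))
        obtain ⟨h1, h2⟩ := mem_filter.1 hh
        obtain ⟨h3, h4⟩ := mem_Icc.1 (primeDiffs_subset _ h1)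
        have h5 : Nat.clog M h ≤ k := (Nat.clog_le_iff_le_pow hM).2 h4
        exact mem_Icc.2 ⟨h3, (Nat.clog_le_iff_le_pow hM).1 (by omega)⟩
    _ = (M : ℝ) ^ (k - 1) := by simp

lemma exists_base_diffBlock : ∃ M : ℕ, ∃ c : ℝ, 3 ≤ M ∧ 0 < c ∧ ∀ k, 1 ≤ k →
    c * (M : ℝ) ^ k ≤ ∑ h ∈ diffBlock M k, (h.totient : ℝ) / h := by
  obtain ⟨c, hc, h⟩ := exists_mul_le_sum_primeDiffs
  obtain ⟨x, hx⟩ := exists_nat_ge (max 2 (2 / c))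
  have hx2 : 2 ≤ x := by exact_mod_cast (le_max_left _ _).trans hx
  obtain ⟨M, hM⟩ : ∃ M : ℕ, M = x ^ 16 := exists_eq
  have hxM : x ≤ M := hM ▸ Nat.le_self_pow (by norm_num) x
  have hM3 : 3 ≤ M := by
    rw [hM]
    calc 3 ≤ 2 ^ 16 := by norm_num
      _ ≤ x ^ 16 := Nat.pow_le_pow_left hx2 16
  have hMc : 2 / c ≤ M := ((le_max_right _ _).trans hx).trans (Nat.cast_le.2 hxM)
  refine ⟨M, c / 2, hM3, by positivity, fun k hk ↦ ?_⟩
  have h1 := h (x ^ k) (hx2.trans (Nat.le_self_pow (by omega) x))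
  rw [← Nat.cast_pow, pow_right_comm x k 16, ← hM, Nat.cast_pow] at h1
  have h2 := sum_diffBlock_ge (by omega : 1 < M) hk
  obtain ⟨j, rfl⟩ : ∃ j, k = j + 1 := ⟨k - 1, by omega⟩
  rw [Nat.add_sub_cancel] at h2
  rw [div_le_iff₀ hc] at hMc
  have h3 : (0 : ℝ) ≤ (M : ℝ) ^ j := by positivity
  have h4 : (M : ℝ) ^ (j + 1) = M ^ j * M := pow_succ _ _
  rw [h4] at h1 ⊢
  nlinarith

lemma eventually_primeCounting_pow_le {M : ℕ} (hM : 3 ≤ M) :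
    ∀ᶠ k : ℕ in atTop, ((M ^ k).primeCounting : ℝ) ≤ 3 * ((M : ℝ) ^ k / k) := by
  have hM' : (3 : ℝ) ≤ M := by exact_mod_cast hM
  have hlogM : 1 ≤ Real.log M := by
    rw [Real.le_log_iff_exp_le (by linarith)]
    linarith [Real.exp_one_lt_d9]
  have h := (tendsto_pow_atTop_atTop_of_one_lt (by linarith : (1 : ℝ) < M)).eventually
    (Chebyshev.eventually_primeCounting_le (zero_lt_one (α := ℝ)))
  filter_upwards [h, eventually_ge_atTop 1] with k hk hk1
  have hk' : (1 : ℝ) ≤ k := by exact_mod_cast hk1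
  rw [← Nat.cast_pow, Nat.floor_natCast, Nat.cast_pow, Real.log_pow] at hk
  refine hk.trans ?_
  have h4 : Real.log 4 ≤ 2 := by
    rw [show (4 : ℝ) = 2 ^ 2 by norm_num, Real.log_pow]
    push_cast
    linarith [Real.log_two_lt_d9]
  rw [← mul_div_assoc]
  gcongr
  · linarith
  · exact le_mul_of_one_le_right (by linarith) hlogM

lemma exists_diverging_blocks {M : ℕ} (hM : 3 ≤ M) (m : ℕ) (K : ℝ) :
    ∃ n, K ≤ ∑ k ∈ Ico (m + 1) n, (M : ℝ) ^ k * gapThreshold (M ^ k).primeCounting := by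
  obtain ⟨k₀, hk₀⟩ := eventually_atTop.1 (eventually_primeCounting_pow_le hM)
  have hM' : (3 : ℝ) ≤ M := by exact_mod_cast hM
  set B := Real.log M with hB
  have hB1 : 1 ≤ B := by
    rw [hB, Real.le_log_iff_exp_le (by linarith)]
    linarith [Real.exp_one_lt_d9]
  have hB2 := Real.log_nonneg hB1
  have hB3 : 0 ≤ Real.log (1 + Real.log B) := Real.log_nonneg (by linarith)
  set D := 3 * B ^ 2 * (1 + Real.log B) * (1 + Real.log (1 + Real.log B))
  have hD0 : 0 < D := by positivity
  obtain ⟨n, hn, hK⟩ := exists_le_sum_inv_mul_L_mul_LL (m := m + 1 + k₀) (by omega) (D * K)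
  refine ⟨n, ?_⟩
  calc K = 1 / D * (D * K) := by field_simp
    _ ≤ 1 / D * ∑ k ∈ Ico (m + 1 + k₀) n, 1 / ((k : ℝ) * L k * LL k) := by gcongr
    _ = ∑ k ∈ Ico (m + 1 + k₀) n, 1 / D * (1 / ((k : ℝ) * L k * LL k)) := mul_sum _ _ _
    _ ≤ ∑ k ∈ Ico (m + 1 + k₀) n, (M : ℝ) ^ k * gapThreshold (M ^ k).primeCounting := by
        refine sum_le_sum fun k hk ↦ ?_
        have hk1 := (mem_Ico.1 hk).1
        have hMk : 2 ≤ M ^ k :=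
          (by omega : 2 ≤ M).trans (Nat.le_self_pow (by omega) M)
        have hπ : 1 ≤ (M ^ k).primeCounting := by
          by_contra hlt
          have := Nat.primeCounting_eq_zero_iff.1 (Nat.lt_one_iff.1 (not_le.1 hlt))
          omega
        refine le_mul_gapThreshold (by omega) hπ (by norm_num) hB1 ?_ (hk₀ k (by omega))
        rw [hB, ← Real.log_pow]
        refine Real.log_le_log (by exact_mod_cast hπ) ?_
        rw [← Nat.cast_pow]
        refine Nat.cast_le.2 ?_
        rw [← Nat.primesLE_card_eq_primeCounting, Nat.primesLE_eq_filter_Icc_one]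
        exact (card_filter_le _ _).trans (by simp)
    _ ≤ _ := sum_le_sum_of_subset_of_nonneg (Ico_subset_Ico_left (by omega)) fun _ _ _ ↦
        mul_nonneg (by positivity) (gapThreshold_nonneg _)

lemma ae_mem_addWellApproximable_diffApprox :
    ∃ M : ℕ, 3 ≤ M ∧ ∀ᵐ x, x ∈ addWellApproximable UnitAddCircle (diffApprox M) := by
  obtain ⟨M, c, hM, hc, hblock⟩ := exists_base_diffBlock
  refine ⟨M, hM, ae_mem_addWellApproximable (diffApprox_nonneg M) (tendsto_diffApprox M) hc
    fun m ↦ ?_⟩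
  obtain ⟨n, hn⟩ := exists_diverging_blocks hM m (1 / c)
  have hdisj : Set.PairwiseDisjoint (Ico (m + 1) n : Set ℕ) (diffBlock M) := by
    intro i _ j _ hij
    refine disjoint_left.2 fun h hi hj ↦ hij ?_
    exact (mem_filter.1 hi).2.symm.trans (mem_filter.1 hj).2
  have hone : ∀ k, ∑ h ∈ diffBlock M k, (h : ℝ) / h = #(diffBlock M k) := fun k ↦ by
    rw [card_eq_sum_ones, Nat.cast_sum]
    refine sum_congr rfl fun h hh ↦ ?_
    have := (mem_Icc.1 (primeDiffs_subset _ (mem_filter.1 hh).1)).1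
    rw [Nat.cast_one, div_self (by exact_mod_cast Nat.one_le_iff_ne_zero.1 this)]
  have hle : ∀ k, ∑ h ∈ diffBlock M k, (h.totient : ℝ) / h ≤ #(diffBlock M k) := fun k ↦ by
    rw [← hone]
    exact sum_le_sum fun h _ ↦ by gcongr; exact Nat.totient_le h
  have hcard : ∀ k, (#(diffBlock M k) : ℝ) ≤ (M : ℝ) ^ k := fun k ↦ by
    have := card_le_card ((filter_subset (fun h ↦ Nat.clog M h = k) _).trans
      (primeDiffs_subset (M ^ k)))
    rw [Nat.card_Icc, Nat.add_sub_cancel] at this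
    exact_mod_cast this
  refine ⟨(Ico (m + 1) n).biUnion (diffBlock M), fun h hh ↦ ?_, ?_, ?_⟩
  · obtain ⟨k, hk, hhk⟩ := mem_biUnion.1 hh
    obtain ⟨h1, h2⟩ := mem_filter.1 hhk
    have h3 := (mem_Icc.1 (primeDiffs_subset _ h1)).1
    refine ⟨?_, h3⟩
    have h4 : m < Nat.clog M h := by have := (mem_Ico.1 hk).1; omega
    have h5 := (Nat.lt_clog_iff_pow_lt (by omega)).1 h4
    exact ((Nat.lt_pow_self (by omega)).trans h5).le
  · rw [sum_biUnion hdisj]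
    calc (1 : ℝ) = c * (1 / c) := by field_simp
      _ ≤ c * ∑ k ∈ Ico (m + 1) n, (M : ℝ) ^ k * gapThreshold (M ^ k).primeCounting := by gcongr
      _ ≤ _ := by
        rw [mul_sum]
        refine sum_le_sum fun k hk ↦ ?_
        rw [sum_diffBlock_mul_diffApprox M k (fun h ↦ h), hone]
        have h1 := (hblock k (by have := (mem_Ico.1 hk).1; omega)).trans (hle k)
        nlinarith [gapThreshold_nonneg (M ^ k).primeCounting]
  · rw [sum_biUnion hdisj, sum_biUnion hdisj, mul_sum]
    refine sum_le_sum fun k hk ↦ ?_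
    rw [sum_diffBlock_mul_diffApprox M k (fun h ↦ h),
      sum_diffBlock_mul_diffApprox M k (fun h ↦ h.totient), hone]
    have h1 := hblock k (by have := (mem_Ico.1 hk).1; omega)
    have h2 : c * (#(diffBlock M k) : ℝ) ≤ ∑ h ∈ diffBlock M k, (h.totient : ℝ) / h :=
      (mul_le_mul_of_nonneg_left (hcard k) hc.le).trans h1
    calc _ = gapThreshold (M ^ k).primeCounting * (c * #(diffBlock M k)) := by ring
      _ ≤ _ := mul_le_mul_of_nonneg_left h2 (gapThreshold_nonneg _)

lemma frequently_deltaMin_le {M : ℕ} (hM : 1 < M) {α : ℝ}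
    (hα : (α : UnitAddCircle) ∈ addWellApproximable UnitAddCircle (diffApprox M)) :
    ∃ᶠ N in atTop, deltaMin nthPrime α N ≤ gapThreshold N := by
  rw [UnitAddCircle.mem_addWellApproximable_iff] at hα
  refine frequently_atTop.2 fun N₀ ↦ ?_
  obtain ⟨n₀, hn₀⟩ := (Nat.tendsto_primeCounting.eventually_ge_atTop N₀).exists
  obtain ⟨n, ⟨a, han, -, hlt⟩, hn⟩ := hα.exists_gt n₀
  have hn0 : (0 : ℝ) < n := by exact_mod_cast (Nat.zero_le _).trans_lt hn
  set X := M ^ Nat.clog M n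
  have hmem : n ∈ primeDiffs X := by
    by_contra hmem
    rw [diffApprox, if_neg hmem] at hlt
    exact absurd hlt (not_lt.2 (norm_nonneg _))
  rw [diffApprox, if_pos hmem] at hlt
  refine ⟨X.primeCounting, hn₀.trans (Nat.monotone_primeCounting
    (hn.le.trans (Nat.le_pow_clog hM n))), (deltaMin_le_of_mem_primeDiffs hmem α).trans ?_⟩
  have h1 : nint (n * α) = ‖n • ((α : UnitAddCircle) - ((a / n : ℝ) : UnitAddCircle))‖ := by
    rw [← AddCircle.coe_sub, ← AddCircle.coe_nsmul, nsmul_eq_mul, mul_sub,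
      mul_div_cancel₀ _ hn0.ne', AddCircle.coe_sub]
    have ha : (((a : ℕ) : ℝ) : UnitAddCircle) = 0 :=
      (AddCircle.coe_eq_zero_iff (1 : ℝ)).2 ⟨a, by simp⟩
    rw [ha, sub_zero, UnitAddCircle.norm_eq, nint]
  rw [h1]
  refine (norm_nsmul_le).trans ?_
  rw [lt_div_iff₀ hn0] at hlt
  linarith

end PrimeGaps

theorem stmt8 :
    ∀ᵐ α ∂(volume : Measure ℝ), α ∈ Set.Icc (0 : ℝ) 1 →
      ∃ᶠ N in atTop,
        deltaMin nthPrime α N ≤ 1 / ((N : ℝ) * (L N) ^ 2 * LL N * LLL N) := by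
  obtain ⟨M, hM, hae⟩ := ae_mem_addWellApproximable_diffApprox
  have h := (UnitAddCircle.measurePreserving_mk 0).quasiMeasurePreserving.ae hae
  rw [zero_add, restrict_Ioc_eq_restrict_Icc, ae_restrict_iff' measurableSet_Icc] at h
  filter_upwards [h] with α hα hmem
  exact frequently_deltaMin_le (by omega) (hα hmem)
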